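/- For all nonnegative integers n, N(0,5;5n+4) = N(1,5;5n+4) and N(1,5;5n+4) = N(2,5;5n+4). -/

import Mathlib

/-- The number of partitions of `n`. -/
noncomputable def partitionFn (n : ℕ) : ℕ := Fintype.card (Nat.Partition n)

/-- The rank of a partition: largest part minus number of parts. -/
def partitionRank {n : ℕ} (P : n.Partition) : ℤ :=
  (P.parts.sup : ℤ) - P.parts.card

/-- `N a b n`: number of partitions of `n` whose rank is congruent to `a` mod `b`. -/
noncomputable def rankCount (a b : ℤ) (n : ℕ) : ℕ :=
  Fintype.card {P : n.Partition // partitionRank P % b = a % b}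

open Filter Topology

/-- The term `(-1)^k Q^{k(k+1)/2}` of a vanishing theta series. -/
noncomputable def thetaTerm (Q : ℂ) (k : ℤ) : ℂ := (-1) ^ k * Q ^ (k * (k + 1) / 2)

/-- The reciprocal `1 / (1 - c Q^k)`, equal to zero when `c Q^k = 1`. -/
noncomputable def qRecip (Q c : ℂ) (k : ℤ) : ℂ := (1 - c * Q ^ k)⁻¹

theorem two_mul_triangle (k : ℤ) : 2 * (k * (k + 1) / 2) = k * (k + 1) :=
  Int.mul_ediv_cancel' (Int.even_mul_succ_self k).two_dvd

theorem triangle_add (k l : ℤ) :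
    (k + l) * (k + l + 1) / 2 = k * (k + 1) / 2 + l * (l + 1) / 2 + k * l := by
  have h1 := two_mul_triangle k
  have h2 := two_mul_triangle l
  have h3 := two_mul_triangle (k + l)
  linarith

theorem thetaTerm_add {Q : ℂ} (hQ : Q ≠ 0) (k l : ℤ) :
    thetaTerm Q (k + l) = thetaTerm Q k * thetaTerm Q l * Q ^ (k * l) := by
  unfold thetaTerm
  rw [triangle_add, zpow_add₀ hQ, zpow_add₀ hQ, zpow_add₀ (by norm_num)]
  ring

@[simp] theorem thetaTerm_zero (Q : ℂ) : thetaTerm Q 0 = 1 := by simp [thetaTerm]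

theorem thetaTerm_one (Q : ℂ) : thetaTerm Q 1 = -Q := by simp [thetaTerm]

theorem thetaTerm_neg_one (Q : ℂ) : thetaTerm Q (-1) = -1 := by simp [thetaTerm]

theorem thetaTerm_add_one {Q : ℂ} (hQ : Q ≠ 0) (k : ℤ) :
    thetaTerm Q (k + 1) = -Q ^ (k + 1) * thetaTerm Q k := by
  rw [thetaTerm_add hQ, thetaTerm_one, zpow_add₀ hQ]
  simp
  ring

theorem thetaTerm_ne_zero {Q : ℂ} (hQ : Q ≠ 0) (k : ℤ) : thetaTerm Q k ≠ 0 := by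
  unfold thetaTerm
  exact mul_ne_zero (zpow_ne_zero _ (by norm_num)) (zpow_ne_zero _ hQ)

theorem thetaTerm_neg {Q : ℂ} (hQ : Q ≠ 0) (k : ℤ) :
    thetaTerm Q (-k) = thetaTerm Q k * Q ^ (-k) := by
  unfold thetaTerm
  rw [mul_assoc, ← zpow_add₀ hQ, zpow_neg, ← inv_zpow]
  have h1 := two_mul_triangle k
  have h2 := two_mul_triangle (-k)
  congr 2
  · norm_num
  · linarith

theorem thetaTerm_neg_one_sub {Q : ℂ} (hQ : Q ≠ 0) (k : ℤ) :
    thetaTerm Q (-1 - k) = -thetaTerm Q k := by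
  rw [sub_eq_add_neg, thetaTerm_add hQ, thetaTerm_neg_one, thetaTerm_neg hQ, mul_assoc, mul_assoc,
    ← zpow_add₀ hQ]
  simp

theorem summable_thetaTerm_mul_zpow {Q : ℂ} (hQ : Q ≠ 0) (hQ1 : ‖Q‖ < 1) {c : ℂ} (hc : c ≠ 0) :
    Summable fun k : ℤ => ‖thetaTerm Q k * c ^ k‖ := by
  have key : ∀ c : ℂ, c ≠ 0 → Summable fun n : ℕ => ‖thetaTerm Q n * c ^ (n : ℤ)‖ := by
    intro c hc
    refine summable_of_ratio_test_tendsto_lt_one zero_lt_one (Eventually.of_forall fun n => ?_)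
      (l := 0) ?_
    · simp [thetaTerm_ne_zero hQ, hc]
    · have : Tendsto (fun n : ℕ => ‖Q‖ ^ (n + 1) * ‖c‖) atTop (𝓝 (0 * ‖c‖)) :=
        ((tendsto_pow_atTop_nhds_zero_of_lt_one (norm_nonneg _) hQ1).comp
          (tendsto_add_atTop_nat 1)).mul_const _
      rw [zero_mul] at this
      refine this.congr fun n => ?_
      have h1 : ‖thetaTerm Q n‖ ≠ 0 := norm_ne_zero_iff.2 (thetaTerm_ne_zero hQ _)
      have h2 : ‖c‖ ≠ 0 := norm_ne_zero_iff.2 hc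
      have h3 : ‖Q‖ ≠ 0 := norm_ne_zero_iff.2 hQ
      push_cast
      rw [thetaTerm_add_one hQ]
      simp only [norm_mul, norm_zpow, norm_neg, norm_norm]
      rw [zpow_add₀ h2, zpow_add₀ h3]
      field_simp
      rw [← zpow_natCast ‖Q‖]
      push_cast
      rw [zpow_add₀ h3]
      simp
  refine Summable.of_nat_of_neg (key c hc) ?_
  refine (key (c⁻¹ * Q⁻¹) (by simp [hc, hQ])).congr fun n => ?_
  rw [thetaTerm_neg hQ, mul_zpow, inv_zpow, inv_zpow, zpow_neg, zpow_neg]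
  congr 1
  ring

theorem summable_thetaTerm {Q : ℂ} (hQ : Q ≠ 0) (hQ1 : ‖Q‖ < 1) :
    Summable fun k : ℤ => ‖thetaTerm Q k‖ := by
  simpa using summable_thetaTerm_mul_zpow hQ hQ1 one_ne_zero

theorem tsum_thetaTerm {Q : ℂ} (hQ : Q ≠ 0) : ∑' k, thetaTerm Q k = 0 := by
  have h := (Equiv.subLeft (-1 : ℤ)).tsum_eq (thetaTerm Q)
  simp only [Equiv.subLeft_apply, thetaTerm_neg_one_sub hQ, tsum_neg] at h
  exact self_eq_neg.1 h.symm

theorem exists_norm_qRecip_le {Q : ℂ} (hQ : Q ≠ 0) (hQ1 : ‖Q‖ < 1) {c : ℂ} (hc : c ≠ 0) :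
    ∃ M, ∀ m : ℤ, ‖qRecip Q c m‖ ≤ M := by
  have h1 : Tendsto (fun n : ℕ => qRecip Q c n) atTop (𝓝 (1 - c * 0)⁻¹) := by
    unfold qRecip
    refine Tendsto.inv₀ (tendsto_const_nhds.sub (Tendsto.const_mul _ ?_)) (by simp)
    simpa using tendsto_pow_atTop_nhds_zero_of_norm_lt_one hQ1
  have h2 : Tendsto (fun n : ℕ => qRecip Q c (-(n : ℤ))) atTop (𝓝 0) := by
    have : Tendsto (fun n : ℕ => Q ^ n * (Q ^ n - c)⁻¹) atTop (𝓝 (0 * (0 - c)⁻¹)) := by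
      have h := tendsto_pow_atTop_nhds_zero_of_norm_lt_one hQ1
      exact h.mul ((h.sub_const c).inv₀ (by simpa using hc))
    rw [zero_mul] at this
    refine this.congr fun n => ?_
    have hn : Q ^ n ≠ 0 := pow_ne_zero _ hQ
    have : 1 - c * Q ^ (-(n : ℤ)) = (Q ^ n - c) / Q ^ n := by
      rw [zpow_neg, zpow_natCast]
      field_simp
    rw [qRecip, this, inv_div, div_eq_mul_inv]
  obtain ⟨M1, hM1⟩ := (Metric.isBounded_range_of_tendsto _ h1).exists_norm_le
  obtain ⟨M2, hM2⟩ := (Metric.isBounded_range_of_tendsto _ h2).exists_norm_le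
  refine ⟨max M1 M2, fun m => ?_⟩
  obtain ⟨n, rfl | rfl⟩ := m.eq_nat_or_neg
  · exact (hM1 _ ⟨n, rfl⟩).trans (le_max_left _ _)
  · exact (hM2 _ ⟨n, rfl⟩).trans (le_max_right _ _)

/-- The condition that `1 - c Q^m` never vanishes. -/
def QGeneric (Q c : ℂ) : Prop := ∀ m : ℤ, c * Q ^ m ≠ 1

/-- The Appell sum `∑ (-1)^k Q^{k(k+1)/2} / (1 - c Q^k)` over all integers. -/
noncomputable def appellSum (Q c : ℂ) : ℂ := ∑' k : ℤ, thetaTerm Q k * qRecip Q c k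

theorem summable_norm_mul_of_bounded {ι : Type*} {f g : ι → ℂ} (hf : Summable fun k => ‖f k‖)
    (hg : ∃ M, ∀ k, ‖g k‖ ≤ M) : Summable fun k => ‖f k * g k‖ := by
  obtain ⟨M, hM⟩ := hg
  refine Summable.of_nonneg_of_le (fun k => norm_nonneg _) (fun k => ?_) (hf.mul_right M)
  rw [norm_mul]
  exact mul_le_mul_of_nonneg_left (hM k) (norm_nonneg _)

theorem qRecip_sub {Q : ℂ} (hQ : Q ≠ 0) (c : ℂ) (l k : ℤ) :
    qRecip Q c (l - k) = qRecip Q (c * Q ^ (-k)) l := by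
  rw [qRecip, qRecip, mul_assoc, ← zpow_add₀ hQ, neg_add_eq_sub]

theorem qRecip_eq_one_add {Q c : ℂ} {k : ℤ} (h : c * Q ^ k ≠ 1) :
    qRecip Q c k = 1 + c * Q ^ k * qRecip Q c k := by
  have h1 : (1 - c * Q ^ k) * qRecip Q c k = 1 := mul_inv_cancel₀ (sub_ne_zero.2 h.symm)
  linear_combination h1

theorem summable_thetaTerm_mul_qRecip {Q : ℂ} (hQ : Q ≠ 0) (hQ1 : ‖Q‖ < 1) {c : ℂ} (hc : c ≠ 0) :
    Summable fun k : ℤ => ‖thetaTerm Q k * qRecip Q c k‖ :=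
  summable_norm_mul_of_bounded (summable_thetaTerm hQ hQ1) (exists_norm_qRecip_le hQ hQ1 hc)

theorem qRecip_inv_neg {Q c : ℂ} (hQ : Q ≠ 0) (hc : c ≠ 0) (k : ℤ) :
    qRecip Q c⁻¹ (-k) = -(c * Q ^ k) * qRecip Q c k := by
  have h : c * Q ^ k ≠ 0 := mul_ne_zero hc (zpow_ne_zero _ hQ)
  unfold qRecip
  rw [zpow_neg, ← mul_inv]
  generalize c * Q ^ k = x at *
  by_cases hx : x = 1
  · simp [hx]
  · have h1 : 1 - x ≠ 0 := sub_ne_zero.2 (Ne.symm hx)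
    have h2 : x - 1 ≠ 0 := sub_ne_zero.2 hx
    have : 1 - x⁻¹ = (x - 1) / x := by field_simp
    rw [this, inv_div, div_eq_iff h2]
    field_simp
    ring

theorem appellSum_inv {Q c : ℂ} (hQ : Q ≠ 0) (hc : c ≠ 0) :
    appellSum Q c⁻¹ = -c * appellSum Q c := by
  unfold appellSum
  rw [← (Equiv.neg ℤ).tsum_eq, ← tsum_mul_left]
  refine tsum_congr fun k => ?_
  have h : Q ^ k ≠ 0 := zpow_ne_zero _ hQ
  simp only [Equiv.neg_apply]
  rw [qRecip_inv_neg hQ hc, thetaTerm_neg hQ, zpow_neg]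
  field_simp

theorem appellSum_one {Q : ℂ} (hQ : Q ≠ 0) : appellSum Q 1 = 0 := by
  have := appellSum_inv hQ one_ne_zero
  simp only [inv_one, neg_mul, one_mul] at this
  exact self_eq_neg.1 this

theorem tsum_thetaTerm_mul_zpow_neg {Q : ℂ} (hQ : Q ≠ 0) :
    ∑' k, thetaTerm Q k * Q ^ (-k) = 0 := by
  rw [← tsum_thetaTerm hQ, ← (Equiv.neg ℤ).tsum_eq (thetaTerm Q)]
  exact tsum_congr fun k => (thetaTerm_neg hQ k).symm

theorem appellSum_mul_aux {Q c : ℂ} (hQ : Q ≠ 0) :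
    appellSum Q (c * Q) = -∑' l, thetaTerm Q l * Q ^ (-l) * qRecip Q c l := by
  unfold appellSum
  rw [← tsum_neg, ← (Equiv.addRight (1 : ℤ)).tsum_eq fun l => -(thetaTerm Q l * Q ^ (-l) *
    qRecip Q c l)]
  refine tsum_congr fun l => ?_
  have h : Q ^ (l + 1) ≠ 0 := zpow_ne_zero _ hQ
  simp only [Equiv.coe_addRight]
  rw [thetaTerm_add_one hQ, zpow_neg, qRecip, qRecip, mul_assoc c, zpow_add_one₀ hQ,
    mul_comm Q]
  rw [zpow_add_one₀ hQ] at h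
  field_simp

theorem appellSum_mul_self {Q c : ℂ} (hQ : Q ≠ 0) (hQ1 : ‖Q‖ < 1) (hc : c ≠ 0)
    (hg : QGeneric Q c) : appellSum Q (c * Q) = -c * appellSum Q c := by
  rw [appellSum_mul_aux hQ]
  have h : ∀ l, thetaTerm Q l * Q ^ (-l) * qRecip Q c l =
      thetaTerm Q l * Q ^ (-l) + c * (thetaTerm Q l * qRecip Q c l) := fun l => by
    have h2 : Q ^ (-l) * Q ^ l = 1 := zpow_neg_mul_zpow_self _ hQ
    linear_combination thetaTerm Q l * Q ^ (-l) * qRecip_eq_one_add (hg l) +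
      thetaTerm Q l * c * qRecip Q c l * h2
  have s1 : Summable fun l => thetaTerm Q l * Q ^ (-l) := by
    simpa using (summable_thetaTerm_mul_zpow hQ hQ1 (inv_ne_zero hQ)).of_norm
  have s2 := (summable_thetaTerm_mul_qRecip hQ hQ1 hc).of_norm
  rw [tsum_congr h, s1.tsum_add (s2.mul_left c), tsum_thetaTerm_mul_zpow_neg hQ, tsum_mul_left,
    zero_add, appellSum, neg_mul]

theorem appellSum_zpow_sub_one {Q : ℂ} (hQ : Q ≠ 0) (hQ1 : ‖Q‖ < 1) (k : ℤ) :
    appellSum Q (Q ^ (-k + 1)) = -Q ^ (-k) * appellSum Q (Q ^ (-k)) + thetaTerm Q k * Q ^ (-k) := by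
  rw [zpow_add_one₀ hQ, appellSum_mul_aux hQ]
  set c := Q ^ (-k) with hcdef
  have hc : c ≠ 0 := zpow_ne_zero _ hQ
  have h : ∀ l, thetaTerm Q l * Q ^ (-l) * qRecip Q c l =
      thetaTerm Q l * Q ^ (-l) + c * (thetaTerm Q l * qRecip Q c l) -
        (if l = k then thetaTerm Q k * c else 0) := fun l => by
    split_ifs with hl
    · subst hl
      have : 1 - c * Q ^ l = 0 := by rw [hcdef, ← zpow_add₀ hQ]; simp
      rw [qRecip, this]
      simp [hcdef]
    · have h1 : c * Q ^ l ≠ 1 := by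
        rw [hcdef, ← zpow_add₀ hQ]
        intro h
        have := congrArg norm h
        rw [norm_zpow, norm_one, zpow_eq_one_iff_right₀ (norm_nonneg _) hQ1.ne] at this
        omega
      have h2 : Q ^ (-l) * Q ^ l = 1 := zpow_neg_mul_zpow_self _ hQ
      linear_combination thetaTerm Q l * Q ^ (-l) * qRecip_eq_one_add h1 +
        thetaTerm Q l * c * qRecip Q c l * h2
  have s1 : Summable fun l => thetaTerm Q l * Q ^ (-l) := by
    simpa using (summable_thetaTerm_mul_zpow hQ hQ1 (inv_ne_zero hQ)).of_norm
  have s2 := (summable_thetaTerm_mul_qRecip hQ hQ1 hc).of_norm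
  rw [tsum_congr h, (s1.add (s2.mul_left c)).tsum_sub (hasSum_ite_eq k _).summable,
    s1.tsum_add (s2.mul_left c), tsum_thetaTerm_mul_zpow_neg hQ, tsum_mul_left, tsum_ite_eq,
    appellSum]
  ring

theorem appellSum_zpow_neg {Q : ℂ} (hQ : Q ≠ 0) (hQ1 : ‖Q‖ < 1) (k : ℤ) :
    appellSum Q (Q ^ (-k)) = thetaTerm Q k * k := by
  have step : ∀ k : ℤ, appellSum Q (Q ^ (-k)) - thetaTerm Q k * k = -Q ^ (-(k + 1)) *
      (appellSum Q (Q ^ (-(k + 1))) - thetaTerm Q (k + 1) * (k + 1 : ℤ)) := fun k => by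
    have h := appellSum_zpow_sub_one hQ hQ1 (k + 1)
    have h1 : Q ^ (k + 1) ≠ 0 := zpow_ne_zero _ hQ
    rw [show -(k + 1) + 1 = -k by ring] at h
    rw [h, thetaTerm_add_one hQ, zpow_neg]
    push_cast
    field_simp
    ring
  rw [← sub_eq_zero]
  induction k using Int.induction_on with
  | zero => simp [appellSum_one hQ]
  | succ n ih =>
    rw [step] at ih
    exact (mul_eq_zero.1 ih).resolve_left (neg_ne_zero.2 (zpow_ne_zero _ hQ))
  | pred n ih =>
    rw [step, sub_add_cancel, ih, mul_zero]

theorem QGeneric.mul_zpow {Q c : ℂ} (hQ : Q ≠ 0) (hg : QGeneric Q c) (k : ℤ) :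
    QGeneric Q (c * Q ^ k) := fun m => by
  rw [mul_assoc, ← zpow_add₀ hQ]
  exact hg _

theorem appellSum_mul_zpow_neg {Q c : ℂ} (hQ : Q ≠ 0) (hQ1 : ‖Q‖ < 1) (hc : c ≠ 0)
    (hg : QGeneric Q c) (k : ℤ) :
    appellSum Q (c * Q ^ (-k)) = thetaTerm Q k * c ^ (-k) * appellSum Q c := by
  have step : ∀ k : ℤ, appellSum Q (c * Q ^ (-k)) - thetaTerm Q k * c ^ (-k) * appellSum Q c =
      -(c * Q ^ (-(k + 1))) * (appellSum Q (c * Q ^ (-(k + 1))) -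
        thetaTerm Q (k + 1) * c ^ (-(k + 1)) * appellSum Q c) := fun k => by
    have h := appellSum_mul_self hQ hQ1 (mul_ne_zero hc (zpow_ne_zero (-(k + 1)) hQ))
      (hg.mul_zpow hQ _)
    have h1 : Q ^ (k + 1) ≠ 0 := zpow_ne_zero _ hQ
    have h2 : c ^ k ≠ 0 := zpow_ne_zero _ hc
    rw [mul_assoc, ← zpow_add_one₀ hQ, show -(k + 1) + 1 = -k by ring] at h
    rw [h, thetaTerm_add_one hQ, zpow_neg Q, zpow_neg c, zpow_neg c, zpow_add_one₀ hc]
    field_simp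
    ring
  rw [← sub_eq_zero]
  induction k using Int.induction_on with
  | zero => simp
  | succ n ih =>
    rw [step] at ih
    exact (mul_eq_zero.1 ih).resolve_left
      (neg_ne_zero.2 (mul_ne_zero hc (zpow_ne_zero _ hQ)))
  | pred n ih =>
    rw [step, sub_add_cancel, ih, mul_zero]

/-- A triple sum whose last two summations are Appell sums shifted by the first index. -/
theorem hasSum_thetaTerm_triple {Q c₁ c₂ : ℂ} (hQ : Q ≠ 0) (hQ1 : ‖Q‖ < 1) (hc₁ : c₁ ≠ 0)
    (hc₂ : c₂ ≠ 0) (hg₁ : QGeneric Q c₁) (hg₂ : QGeneric Q c₂) {f : ℤ → ℂ}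
    (hf : Summable fun k => ‖thetaTerm Q k * f k‖) :
    HasSum (fun p : ℤ × ℤ × ℤ => thetaTerm Q p.1 * f p.1 *
        ((thetaTerm Q p.2.1 * qRecip Q c₁ (p.2.1 - p.1)) *
          (thetaTerm Q p.2.2 * qRecip Q c₂ (p.2.2 - p.1))))
      (appellSum Q c₁ * appellSum Q c₂ *
        ∑' k, thetaTerm Q k ^ 3 * f k * (c₁ * c₂) ^ (-k)) := by
  have hs : Summable (fun p : ℤ × ℤ × ℤ => thetaTerm Q p.1 * f p.1 *
        ((thetaTerm Q p.2.1 * qRecip Q c₁ (p.2.1 - p.1)) *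
          (thetaTerm Q p.2.2 * qRecip Q c₂ (p.2.2 - p.1)))) := by
    obtain ⟨M₁, hM₁⟩ := exists_norm_qRecip_le hQ hQ1 hc₁
    obtain ⟨M₂, hM₂⟩ := exists_norm_qRecip_le hQ hQ1 hc₂
    have hw := summable_thetaTerm hQ hQ1
    have h3 := hf.mul_norm (hw.mul_norm hw)
    have h4 : Summable fun p : ℤ × ℤ × ℤ =>
        ‖thetaTerm Q p.1 * f p.1 * (thetaTerm Q p.2.1 * thetaTerm Q p.2.2)‖ := by
      simpa using h3
    refine ((summable_norm_mul_of_bounded h4 (g := fun p => qRecip Q c₁ (p.2.1 - p.1) *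
      qRecip Q c₂ (p.2.2 - p.1)) ⟨M₁ * M₂, fun p => ?_⟩).congr fun p => ?_).of_norm
    · rw [norm_mul]
      exact mul_le_mul (hM₁ _) (hM₂ _) (norm_nonneg _) ((norm_nonneg _).trans (hM₁ 0))
    · congr 1
      ring
  have key : ∀ c, c ≠ 0 → QGeneric Q c → ∀ k, ∑' l, thetaTerm Q l * qRecip Q c (l - k) =
      thetaTerm Q k * c ^ (-k) * appellSum Q c := fun c hc hg k => by
    rw [← appellSum_mul_zpow_neg hQ hQ1 hc hg k, appellSum]
    exact tsum_congr fun l => by rw [qRecip_sub hQ]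
  have key2 : ∀ c, c ≠ 0 → ∀ k, Summable fun l => ‖thetaTerm Q l * qRecip Q c (l - k)‖ :=
    fun c hc k => (summable_thetaTerm_mul_qRecip hQ hQ1
      (mul_ne_zero hc (zpow_ne_zero (-k) hQ))).congr fun l => by rw [qRecip_sub hQ]
  convert hs.hasSum using 1
  rw [hs.tsum_prod, ← tsum_mul_left]
  refine tsum_congr fun k => ?_
  dsimp only
  rw [tsum_mul_left, ← tsum_mul_tsum_of_summable_norm (key2 c₁ hc₁ k) (key2 c₂ hc₂ k),
    key c₁ hc₁ hg₁, key c₂ hc₂ hg₂, mul_zpow]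
  ring

/-- The cubic Appell sum `∑ (-1)^k Q^{3k(k+1)/2} x^k / (1 - b Q^k)`. -/
noncomputable def cubeAppell (Q b x : ℂ) : ℂ := ∑' k : ℤ, thetaTerm Q k ^ 3 * x ^ k * qRecip Q b k

/-- The theta series `∑ (-1)^k Q^{k(3k+1)/2} x^k`. -/
noncomputable def cubeTheta (Q x : ℂ) : ℂ := ∑' k : ℤ, thetaTerm Q k ^ 3 * Q ^ (-k) * x ^ k

theorem hasSum_of_pointwise_eq {ι : Type*} {f g : ι → ℂ} {a : ℂ} (h : HasSum g a)
    (hfg : ∀ i, f i = g i) : HasSum f a :=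
  (funext hfg : f = g) ▸ h

theorem inv_one_sub_div {A B : ℂ} (hA : A ≠ 0) : (1 - B / A)⁻¹ = A / (A - B) := by
  rw [one_sub_div hA, inv_div]

theorem inv_one_sub_mul_three {A B C : ℂ} (hA : A ≠ 0) (hB : B ≠ 0) (hC : C ≠ 0) (hA1 : A ≠ 1)
    (hB1 : B ≠ 1) (hC1 : C ≠ 1) (hAB : A ≠ B) (hAC : A ≠ C) (hBC : B ≠ C) :
    (1 - A)⁻¹ * (1 - B)⁻¹ * (1 - C)⁻¹ = (1 - A)⁻¹ * ((1 - B / A)⁻¹ * (1 - C / A)⁻¹) +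
      (1 - B)⁻¹ * ((1 - A / B)⁻¹ * (1 - C / B)⁻¹) +
      (1 - C)⁻¹ * ((1 - A / C)⁻¹ * (1 - B / C)⁻¹) := by
  simp only [inv_one_sub_div hA, inv_one_sub_div hB, inv_one_sub_div hC]
  have h1 := sub_ne_zero.2 hA1.symm
  have h2 := sub_ne_zero.2 hB1.symm
  have h3 := sub_ne_zero.2 hC1.symm
  have h4 := sub_ne_zero.2 hAB
  have h5 := sub_ne_zero.2 hAC
  have h6 := sub_ne_zero.2 hBC
  rw [← neg_sub A B, ← neg_sub A C, ← neg_sub B C]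
  field_simp
  ring

theorem inv_mul_inv_one_sub_add {A B C : ℂ} (hA : A ≠ 0) (hB : B ≠ 0) (hC : C ≠ 0)
    (hAB : A ≠ B) (hAC : A ≠ C) (hBC : B ≠ C) :
    A⁻¹ * ((1 - B / A)⁻¹ * (1 - C / A)⁻¹) + B⁻¹ * ((1 - A / B)⁻¹ * (1 - C / B)⁻¹) +
      C⁻¹ * ((1 - A / C)⁻¹ * (1 - B / C)⁻¹) = 0 := by
  simp only [inv_one_sub_div hA, inv_one_sub_div hB, inv_one_sub_div hC]
  have h4 := sub_ne_zero.2 hAB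
  have h5 := sub_ne_zero.2 hAC
  have h6 := sub_ne_zero.2 hBC
  rw [← neg_sub A B, ← neg_sub A C, ← neg_sub B C]
  field_simp
  ring

theorem QGeneric.inv {Q c : ℂ} (hg : QGeneric Q c) : QGeneric Q c⁻¹ := fun m h =>
  hg (-m) (by rw [zpow_neg, ← inv_inv c, ← mul_inv, h, inv_one])

theorem QGeneric.div_symm {Q a b : ℂ} (hg : QGeneric Q (a / b)) : QGeneric Q (b / a) := by
  simpa using hg.inv

theorem QGeneric.mul_zpow_ne {Q a b : ℂ} (hQ : Q ≠ 0) (hb : b ≠ 0)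
    (hg : QGeneric Q (a / b)) (k l : ℤ) : a * Q ^ k ≠ b * Q ^ l := fun h => by
  refine hg (k - l) ?_
  have := zpow_ne_zero l hQ
  rw [zpow_sub₀ hQ, div_mul_div_comm, h, div_self (mul_ne_zero hb this)]

theorem qRecip_div_sub {Q : ℂ} (hQ : Q ≠ 0) (a b : ℂ) (k l : ℤ) :
    qRecip Q (a / b) (k - l) = (1 - (a * Q ^ k) / (b * Q ^ l))⁻¹ := by
  rw [qRecip, zpow_sub₀ hQ, div_mul_div_comm]

/-- The reordering of a triple that brings the second entry to the front. -/
def tripleSecond : ℤ × ℤ × ℤ ≃ ℤ × ℤ × ℤ where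
  toFun p := (p.2.1, p.1, p.2.2)
  invFun p := (p.2.1, p.1, p.2.2)
  left_inv _ := rfl
  right_inv _ := rfl

/-- The reordering of a triple that brings the third entry to the front. -/
def tripleThird : ℤ × ℤ × ℤ ≃ ℤ × ℤ × ℤ where
  toFun p := (p.2.2, p.1, p.2.1)
  invFun p := (p.2.1, p.2.2, p.1)
  left_inv _ := rfl
  right_inv _ := rfl

theorem hasSum_triple_mul {f g h : ℤ → ℂ} (hf : Summable fun k => ‖f k‖)
    (hg : Summable fun k => ‖g k‖) (hh : Summable fun k => ‖h k‖) :
    HasSum (fun p : ℤ × ℤ × ℤ => f p.1 * (g p.2.1 * h p.2.2))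
      ((∑' k, f k) * ((∑' k, g k) * ∑' k, h k)) := by
  have hgh : Summable fun p : ℤ × ℤ => ‖g p.1 * h p.2‖ := hg.mul_norm hh
  rw [tsum_mul_tsum_of_summable_norm hg hh, tsum_mul_tsum_of_summable_norm hf hgh]
  exact (hf.mul_norm hgh).of_norm.hasSum

theorem appellSum_mul_three {Q a b c : ℂ} (hQ : Q ≠ 0) (hQ1 : ‖Q‖ < 1) (ha : a ≠ 0) (hb : b ≠ 0)
    (hc : c ≠ 0) (ga : QGeneric Q a) (gb : QGeneric Q b) (gc : QGeneric Q c)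
    (gab : QGeneric Q (a / b)) (gac : QGeneric Q (a / c)) (gbc : QGeneric Q (b / c)) :
    appellSum Q a * appellSum Q b * appellSum Q c =
      appellSum Q (b / a) * appellSum Q (c / a) * cubeAppell Q a (a ^ 2 / (b * c)) +
      appellSum Q (a / b) * appellSum Q (c / b) * cubeAppell Q b (b ^ 2 / (a * c)) +
      appellSum Q (a / c) * appellSum Q (b / c) * cubeAppell Q c (c ^ 2 / (a * b)) := by
  have s : ∀ c, c ≠ 0 → Summable fun k => ‖thetaTerm Q k * qRecip Q c k‖ :=
    fun c hc => summable_thetaTerm_mul_qRecip hQ hQ1 hc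
  have e : ∀ a b c : ℂ, a ≠ 0 → b ≠ 0 → c ≠ 0 →
      (∑' k, thetaTerm Q k ^ 3 * qRecip Q a k * ((b / a) * (c / a)) ^ (-k)) =
      cubeAppell Q a (a ^ 2 / (b * c)) := fun a b c ha hb hc => tsum_congr fun k => by
    rw [show a ^ 2 / (b * c) = ((b / a) * (c / a))⁻¹ by field_simp, inv_zpow, zpow_neg]
    ring
  have H1 := hasSum_thetaTerm_triple hQ hQ1 (div_ne_zero hb ha) (div_ne_zero hc ha) gab.div_symm
    gac.div_symm (s a ha)
  have H2 := (tripleSecond.hasSum_iff).2 (hasSum_thetaTerm_triple hQ hQ1 (div_ne_zero ha hb)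
    (div_ne_zero hc hb) gab gbc.div_symm (s b hb))
  have H3 := (tripleThird.hasSum_iff).2 (hasSum_thetaTerm_triple hQ hQ1 (div_ne_zero ha hc)
    (div_ne_zero hb hc) gac gbc (s c hc))
  have H := (H1.add H2).add H3
  rw [e a b c ha hb hc, e b a c hb ha hc, e c a b hc ha hb] at H
  rw [← H.unique (a₂ := appellSum Q a * appellSum Q b * appellSum Q c)]
  rw [mul_assoc]
  refine hasSum_of_pointwise_eq (hasSum_triple_mul (s a ha) (s b hb) (s c hc)) fun p => ?_
  obtain ⟨k, l, m⟩ := p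
  have hk := zpow_ne_zero k hQ
  have hl := zpow_ne_zero l hQ
  have hm := zpow_ne_zero m hQ
  have key := inv_one_sub_mul_three (mul_ne_zero ha hk) (mul_ne_zero hb hl) (mul_ne_zero hc hm)
    (ga k) (gb l) (gc m) (gab.mul_zpow_ne hQ hb k l) (gac.mul_zpow_ne hQ hc k m)
    (gbc.mul_zpow_ne hQ hc l m)
  simp only [tripleSecond, tripleThird, Function.comp, Equiv.coe_fn_mk, qRecip_div_sub hQ] at *
  simp only [qRecip]
  linear_combination (-thetaTerm Q k * thetaTerm Q l * thetaTerm Q m) * key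

theorem appellSum_mul_cubeTheta_add {Q a b c : ℂ} (hQ : Q ≠ 0) (hQ1 : ‖Q‖ < 1) (ha : a ≠ 0)
    (hb : b ≠ 0) (hc : c ≠ 0) (gab : QGeneric Q (a / b)) (gac : QGeneric Q (a / c))
    (gbc : QGeneric Q (b / c)) :
    a⁻¹ * (appellSum Q (b / a) * appellSum Q (c / a) * cubeTheta Q (a ^ 2 / (b * c))) +
      b⁻¹ * (appellSum Q (a / b) * appellSum Q (c / b) * cubeTheta Q (b ^ 2 / (a * c))) +
      c⁻¹ * (appellSum Q (a / c) * appellSum Q (b / c) * cubeTheta Q (c ^ 2 / (a * b))) = 0 := by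
  have s : Summable fun k : ℤ => ‖thetaTerm Q k * Q ^ (-k)‖ := by
    simpa using summable_thetaTerm_mul_zpow hQ hQ1 (inv_ne_zero hQ)
  have e : ∀ a b c : ℂ, a ≠ 0 → b ≠ 0 → c ≠ 0 →
      (∑' k : ℤ, thetaTerm Q k ^ 3 * Q ^ (-k) * ((b / a) * (c / a)) ^ (-k)) =
      cubeTheta Q (a ^ 2 / (b * c)) := fun a b c ha hb hc => tsum_congr fun k => by
    rw [show a ^ 2 / (b * c) = ((b / a) * (c / a))⁻¹ by field_simp, inv_zpow, zpow_neg _ k,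
      zpow_neg _ k]
  have H1 := hasSum_thetaTerm_triple hQ hQ1 (div_ne_zero hb ha) (div_ne_zero hc ha) gab.div_symm
    gac.div_symm s
  have H2 := (tripleSecond.hasSum_iff).2 (hasSum_thetaTerm_triple hQ hQ1 (div_ne_zero ha hb)
    (div_ne_zero hc hb) gab gbc.div_symm s)
  have H3 := (tripleThird.hasSum_iff).2 (hasSum_thetaTerm_triple hQ hQ1 (div_ne_zero ha hc)
    (div_ne_zero hb hc) gac gbc s)
  have H := ((H1.mul_left a⁻¹).add (H2.mul_left b⁻¹)).add (H3.mul_left c⁻¹)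
  rw [e a b c ha hb hc, e b a c hb ha hc, e c a b hc ha hb] at H
  refine H.unique ?_
  refine hasSum_of_pointwise_eq hasSum_zero fun p => ?_
  obtain ⟨k, l, m⟩ := p
  have hk := zpow_ne_zero k hQ
  have hl := zpow_ne_zero l hQ
  have hm := zpow_ne_zero m hQ
  have key := inv_mul_inv_one_sub_add (mul_ne_zero ha hk) (mul_ne_zero hb hl) (mul_ne_zero hc hm)
    (gab.mul_zpow_ne hQ hb k l) (gac.mul_zpow_ne hQ hc k m) (gbc.mul_zpow_ne hQ hc l m)
  simp only [tripleSecond, tripleThird, Function.comp, Equiv.coe_fn_mk, qRecip_div_sub hQ] at *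
  rw [mul_inv, mul_inv, mul_inv, ← zpow_neg, ← zpow_neg, ← zpow_neg] at key
  linear_combination (thetaTerm Q k * thetaTerm Q l * thetaTerm Q m) * key

/-- The indicator function of the nonnegative integers. -/
def nonnegInd (k : ℤ) : ℂ := if 0 ≤ k then 1 else 0

/-- The regularized sum of `1 / (1 - c Q^k)` over all integers. -/
noncomputable def qRecipSum (Q c : ℂ) : ℂ := ∑' k : ℤ, (qRecip Q c k - nonnegInd k)

theorem summable_pow_natAbs {r : ℝ} (hr : 0 ≤ r) (hr1 : r < 1) :
    Summable fun k : ℤ => r ^ k.natAbs :=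
  Summable.of_nat_of_neg (by simpa using summable_geometric_of_lt_one hr hr1)
    (by simpa using summable_geometric_of_lt_one hr hr1)

theorem exists_norm_qRecip_sub_le {Q : ℂ} (hQ : Q ≠ 0) (hQ1 : ‖Q‖ < 1) {c : ℂ} (hc : c ≠ 0) :
    ∃ C, ∀ k : ℤ, ‖qRecip Q c k - nonnegInd k‖ ≤ C * ‖Q‖ ^ k.natAbs := by
  obtain ⟨M, hM⟩ := exists_norm_qRecip_le hQ hQ1 hc
  obtain ⟨M', hM'⟩ := exists_norm_qRecip_le hQ hQ1 (inv_ne_zero hc)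
  have hM0 : 0 ≤ M := (norm_nonneg _).trans (hM 0)
  have hM0' : 0 ≤ M' := (norm_nonneg _).trans (hM' 0)
  refine ⟨‖c‖ * (M + 1) + ‖c‖⁻¹ * M', fun k => ?_⟩
  rcases le_or_gt 0 k with hk | hk
  · obtain ⟨n, rfl⟩ := Int.eq_ofNat_of_zero_le hk
    have h1 : ‖qRecip Q c n - 1‖ ≤ ‖c‖ * (M + 1) * ‖Q‖ ^ n := by
      by_cases h : c * Q ^ (n : ℤ) = 1
      · have h2 : ‖c‖ * ‖Q‖ ^ n = 1 := by simpa using congrArg norm h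
        rw [qRecip, h]
        simp only [sub_self, inv_zero, zero_sub, norm_neg, norm_one]
        nlinarith
      · rw [qRecip_eq_one_add h, add_sub_cancel_left, norm_mul, norm_mul, zpow_natCast, norm_pow]
        nlinarith [hM n, mul_nonneg (norm_nonneg c) (pow_nonneg (norm_nonneg Q) n)]
    simp only [nonnegInd, hk, if_true, Int.natAbs_natCast]
    have : 0 ≤ ‖c‖⁻¹ * M' * ‖Q‖ ^ n := by positivity
    nlinarith
  · obtain ⟨n, hn⟩ := Int.eq_ofNat_of_zero_le (neg_nonneg.2 hk.le)
    obtain rfl : k = -(n : ℤ) := by rw [← hn, neg_neg]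
    have h1 : ‖qRecip Q c (-n)‖ ≤ ‖c‖⁻¹ * M' * ‖Q‖ ^ n := by
      have h := qRecip_inv_neg hQ (inv_ne_zero hc) (n : ℤ)
      rw [inv_inv] at h
      rw [h, norm_mul, norm_neg, norm_mul, zpow_natCast, norm_pow, norm_inv]
      nlinarith [hM' n, mul_nonneg (inv_nonneg.2 (norm_nonneg c)) (pow_nonneg (norm_nonneg Q) n)]
    simp only [nonnegInd, hk.not_ge, if_false, Int.natAbs_neg, Int.natAbs_natCast, sub_zero]
    have : 0 ≤ ‖c‖ * (M + 1) * ‖Q‖ ^ n := by positivity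
    nlinarith

theorem summable_qRecip_sub {Q : ℂ} (hQ : Q ≠ 0) (hQ1 : ‖Q‖ < 1) {c : ℂ} (hc : c ≠ 0) :
    Summable fun k : ℤ => ‖qRecip Q c k - nonnegInd k‖ := by
  obtain ⟨C, hC⟩ := exists_norm_qRecip_sub_le hQ hQ1 hc
  exact Summable.of_nonneg_of_le (fun k => norm_nonneg _) hC
    ((summable_pow_natAbs (norm_nonneg _) hQ1).mul_left C)

theorem nonnegInd_sub_add_one (j l : ℤ) :
    nonnegInd (j + l) - nonnegInd (j + (l + 1)) = if j = -l - 1 then -1 else 0 := by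
  unfold nonnegInd
  split_ifs <;> first | omega | simp

theorem hasSum_nonnegInd_sub (l : ℤ) :
    HasSum (fun j => nonnegInd j - nonnegInd (j + l)) (-l : ℂ) := by
  have step : ∀ l : ℤ, HasSum (fun j => nonnegInd (j + l) - nonnegInd (j + (l + 1))) (-1 : ℂ) := by
    intro l
    simp only [nonnegInd_sub_add_one]
    exact hasSum_ite_eq _ _
  induction l using Int.induction_on with
  | zero => simp
  | succ n ih =>
    convert ih.add (step n) using 1
    · funext j
      ring
    · push_cast
      ring
  | pred n ih =>
    have e : -((-(n : ℤ) - 1 : ℤ) : ℂ) = -((-(n : ℤ) : ℤ) : ℂ) - -1 := by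
      push_cast
      ring
    rw [e]
    refine hasSum_of_pointwise_eq (ih.sub (step (-n - 1))) fun j => ?_
    rw [sub_add_cancel]
    ring

theorem qRecipSum_mul_self {Q c : ℂ} (hQ : Q ≠ 0) (hQ1 : ‖Q‖ < 1) (hc : c ≠ 0) :
    qRecipSum Q (c * Q) = qRecipSum Q c + 1 := by
  have h := (summable_qRecip_sub hQ hQ1 hc).of_norm.hasSum.add (hasSum_nonnegInd_sub (-1))
  rw [← (Equiv.addRight (1 : ℤ)).hasSum_iff] at h
  have h2 : ((fun k : ℤ => qRecip Q c k - nonnegInd k + (nonnegInd k - nonnegInd (k + -1))) ∘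
      (Equiv.addRight (1 : ℤ))) = fun k => qRecip Q (c * Q) k - nonnegInd k := by
    funext k
    simp only [Function.comp, Equiv.coe_addRight, add_neg_cancel_right, sub_add_sub_cancel]
    rw [qRecip, qRecip, zpow_add_one₀ hQ, mul_assoc c Q, mul_comm Q]
  rw [h2] at h
  rw [qRecipSum, h.tsum_eq, qRecipSum]
  push_cast
  ring

theorem nonnegInd_neg (k : ℤ) : nonnegInd (-k) = 1 - nonnegInd k + if k = 0 then 1 else 0 := by
  unfold nonnegInd
  split_ifs <;> first | omega | simp

theorem qRecipSum_inv {Q c : ℂ} (hQ : Q ≠ 0) (hQ1 : ‖Q‖ < 1) (hc : c ≠ 0) (hg : QGeneric Q c) :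
    qRecipSum Q c⁻¹ = -qRecipSum Q c - 1 := by
  have h := (summable_qRecip_sub hQ hQ1 hc).of_norm.hasSum.neg.add
    (hasSum_ite_eq (0 : ℤ) (-1 : ℂ))
  rw [qRecipSum, ← (Equiv.neg ℤ).tsum_eq, sub_eq_add_neg, qRecipSum, ← h.tsum_eq]
  refine tsum_congr fun k => ?_
  simp only [Equiv.neg_apply]
  rw [qRecip_inv_neg hQ hc, nonnegInd_neg]
  have := qRecip_eq_one_add (hg k)
  split_ifs <;> linear_combination this

theorem zpow_ne_one_of_norm_lt {Q : ℂ} (hQ : Q ≠ 0) (hQ1 : ‖Q‖ < 1) {k : ℤ} (hk : k ≠ 0) :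
    Q ^ k ≠ 1 := fun h => by
  have h1 := congrArg norm h
  have h2 : 0 < ‖Q‖ := norm_pos_iff.2 hQ
  rw [norm_zpow, norm_one, zpow_eq_one_iff_right₀ (norm_nonneg _) hQ1.ne] at h1
  exact hk h1

theorem qRecipSum_one {Q : ℂ} (hQ : Q ≠ 0) (hQ1 : ‖Q‖ < 1) : qRecipSum Q 1 = -1 := by
  have h := (summable_qRecip_sub hQ hQ1 one_ne_zero).of_norm.hasSum.neg.add
    (hasSum_ite_eq (0 : ℤ) (-2 : ℂ))
  have h2 : qRecipSum Q 1 = -qRecipSum Q 1 + -2 := by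
    conv_lhs => rw [qRecipSum, ← (Equiv.neg ℤ).tsum_eq]
    rw [qRecipSum, ← h.tsum_eq]
    refine tsum_congr fun k => ?_
    simp only [Equiv.neg_apply]
    have h3 := qRecip_inv_neg hQ one_ne_zero k
    rw [inv_one] at h3
    rw [h3, nonnegInd_neg]
    split_ifs with hk
    · subst hk
      simp [qRecip, nonnegInd]
      norm_num
    · have := qRecip_eq_one_add (c := 1) (k := k) (by
        rw [one_mul]
        exact zpow_ne_one_of_norm_lt hQ hQ1 hk)
      linear_combination this
  linear_combination h2 / 2

theorem summable_int_mul {f : ℤ → ℂ} {r : ℝ} (hr : 0 < r) (hr1 : r < 1)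
    (hf : Summable fun l => ‖f l‖ * (r ^ l + r ^ (-l))) :
    Summable fun p : ℤ × ℤ => f p.1 * (nonnegInd p.2 - nonnegInd (p.2 + p.1)) := by
  have hp := summable_pow_natAbs hr.le hr1
  refine Summable.of_norm_bounded (hf.mul_of_nonneg hp (fun l => by positivity)
    fun k => by positivity) fun ⟨l, j⟩ => ?_
  rw [norm_mul, mul_assoc]
  refine mul_le_mul_of_nonneg_left ?_ (norm_nonneg _)
  have h1 : r ^ l.natAbs * (r ^ l + r ^ (-l)) ≥ 1 := by
    obtain ⟨n, rfl | rfl⟩ := l.eq_nat_or_neg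
    · have : r ^ n * r ^ (-(n : ℤ)) = 1 := by
        rw [← zpow_natCast, ← zpow_add₀ hr.ne']
        simp
      simp only [Int.natAbs_natCast]
      nlinarith [mul_pos (pow_pos hr n) (zpow_pos hr (n : ℤ))]
    · have : r ^ n * r ^ (-(n : ℤ)) = 1 := by
        rw [← zpow_natCast, ← zpow_add₀ hr.ne']
        simp
      simp only [Int.natAbs_neg, Int.natAbs_natCast, neg_neg]
      nlinarith [mul_pos (pow_pos hr n) (zpow_pos hr (n : ℤ))]
  have h0 : 0 ≤ (r ^ l + r ^ (-l)) * r ^ j.natAbs := by positivity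
  by_cases hjl : j.natAbs ≤ l.natAbs
  · have h2 : r ^ l.natAbs ≤ r ^ j.natAbs := pow_le_pow_of_le_one hr.le hr1.le hjl
    have h3 : 0 ≤ r ^ l + r ^ (-l) := by positivity
    have h4 : ‖nonnegInd j - nonnegInd (j + l)‖ ≤ 1 := by
      unfold nonnegInd
      split_ifs <;> simp
    nlinarith
  · have : nonnegInd j - nonnegInd (j + l) = 0 := by
      unfold nonnegInd
      split_ifs <;> first | omega | simp
    rw [this, norm_zero]
    exact h0

theorem inv_one_sub_mul_two {A B : ℂ} (hA : A ≠ 0) (hB : B ≠ 0) (hA1 : A ≠ 1) (hB1 : B ≠ 1)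
    (hAB : A ≠ B) : (1 - A)⁻¹ * (1 - B)⁻¹ =
      (1 - A)⁻¹ * (1 - B / A)⁻¹ + (1 - B)⁻¹ * (1 - A / B)⁻¹ := by
  simp only [inv_one_sub_div hA, inv_one_sub_div hB]
  have h1 := sub_ne_zero.2 hA1.symm
  have h2 := sub_ne_zero.2 hB1.symm
  have h4 := sub_ne_zero.2 hAB
  rw [← neg_sub A B]
  field_simp
  ring

theorem inv_one_sub_degenerate {B C : ℂ} (hB : B ≠ 0) (hC : C ≠ 0) (hB1 : B ≠ 1) (hC1 : C ≠ 1)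
    (hBC : B ≠ C) :
    (1 - B)⁻¹ * ((1 - 1 / B)⁻¹ * (1 - C / B)⁻¹) + (1 - C)⁻¹ * ((1 - 1 / C)⁻¹ * (1 - B / C)⁻¹) +
      B * (1 - B)⁻¹ ^ 2 * (1 - C)⁻¹ + (1 - B)⁻¹ * (C * (1 - C)⁻¹ ^ 2) = 0 := by
  simp only [inv_one_sub_div hB, inv_one_sub_div hC]
  have h1 := sub_ne_zero.2 hB1.symm
  have h2 := sub_ne_zero.2 hC1.symm
  have h4 := sub_ne_zero.2 hBC
  rw [← neg_sub B C, ← neg_sub 1 B, ← neg_sub 1 C]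
  field_simp
  ring

theorem hasSum_diagonal {f : ℤ → ℂ} {a : ℂ} (hf : HasSum f a) :
    HasSum (fun p : ℤ × ℤ => if p.2 = p.1 then f p.1 else 0) a := by
  have hi : Function.Injective fun l : ℤ => (l, l) := fun l m h => (Prod.ext_iff.1 h).1
  rw [← hi.hasSum_iff]
  · simpa [Function.comp_def] using hf
  · rintro ⟨l, k⟩ h
    have : k ≠ l := fun e => h ⟨l, by simp [e]⟩
    simp [this]

theorem summable_thetaTerm_mul_qRecip_mul {Q : ℂ} (hQ : Q ≠ 0) (hQ1 : ‖Q‖ < 1) {b : ℂ}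
    (hb : b ≠ 0) : Summable fun l : ℤ => ‖thetaTerm Q l * qRecip Q b l‖ *
      (‖Q‖ ^ l + ‖Q‖ ^ (-l)) := by
  have h1 := summable_norm_mul_of_bounded (summable_thetaTerm_mul_zpow hQ hQ1 hQ)
    (exists_norm_qRecip_le hQ hQ1 hb)
  have h2 := summable_norm_mul_of_bounded (summable_thetaTerm_mul_zpow hQ hQ1 (inv_ne_zero hQ))
    (exists_norm_qRecip_le hQ hQ1 hb)
  refine (h1.add h2).congr fun l => ?_
  simp only [norm_mul, norm_zpow, norm_inv, inv_zpow, zpow_neg]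
  ring

theorem hasSum_thetaTerm_mul_qRecip_diff {Q : ℂ} (hQ : Q ≠ 0) (hQ1 : ‖Q‖ < 1) {b : ℂ}
    (hb : b ≠ 0) : ∃ a, HasSum (fun p : ℤ × ℤ => thetaTerm Q p.1 * qRecip Q b p.1 *
        (qRecip Q 1 (p.2 - p.1) - nonnegInd p.2)) a ∧
      HasSum (fun l : ℤ => thetaTerm Q l * qRecip Q b l * (-1 - l)) a := by
  have hs := (summable_thetaTerm_mul_qRecip hQ hQ1 hb)
  have he := summable_qRecip_sub hQ hQ1 one_ne_zero
  have h1 := (hs.mul_norm he).of_norm.hasSum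
  have h2 := (summable_int_mul (norm_pos_iff.2 hQ) hQ1
    (summable_thetaTerm_mul_qRecip_mul hQ hQ1 hb)).hasSum
  have h := h1.add h2
  refine ⟨_, ?_, h.prod_fiberwise fun l => ?_⟩
  · rw [← (Equiv.prodShear (Equiv.refl ℤ) fun l : ℤ => Equiv.subRight l).hasSum_iff] at h
    refine hasSum_of_pointwise_eq h fun p => ?_
    simp only [Function.comp, Equiv.prodShear_apply, Equiv.refl_apply, Equiv.subRight_apply,
      sub_add_cancel]
    ring
  · have h3 := he.of_norm.hasSum
    rw [show ∑' k, (qRecip Q 1 k - nonnegInd k) = -1 from qRecipSum_one hQ hQ1] at h3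
    have h4 := (h3.mul_left (thetaTerm Q l * qRecip Q b l)).add
      ((hasSum_nonnegInd_sub l).mul_left (thetaTerm Q l * qRecip Q b l))
    have e : ∀ x y : ℂ, x * (-1 - y) = x * -1 + x * -y := fun x y => by ring
    rw [e]
    exact h4

theorem hasSum_appellSum_mul_qRecipSum {Q : ℂ} (hQ : Q ≠ 0) (hQ1 : ‖Q‖ < 1) {b : ℂ} (hb : b ≠ 0)
    (hg : QGeneric Q b) :
    HasSum (fun l : ℤ => thetaTerm Q l * (b * Q ^ l * qRecip Q b l ^ 2))
      (appellSum Q b * qRecipSum Q b) := by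
  have hs := summable_thetaTerm_mul_qRecip hQ hQ1 hb
  have he := summable_qRecip_sub hQ hQ1 hb
  have h0 := (hs.mul_norm he).of_norm.hasSum
  rw [← tsum_mul_tsum_of_summable_norm hs he] at h0
  obtain ⟨a, h1, h1'⟩ := hasSum_thetaTerm_mul_qRecip_diff hQ hQ1 hb
  have h2' := (summable_norm_mul_of_bounded hs (exists_norm_qRecip_le hQ hQ1 hb)).of_norm.hasSum
  have h2 := hasSum_diagonal h2'
  have h3 := (h0.sub h1).sub h2
  rw [← (Equiv.prodComm ℤ ℤ).hasSum_iff] at h3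
  have h3' := h3.prod_fiberwise (g := fun k => qRecip Q b k * (thetaTerm Q k * k)) fun k => by
    rw [← appellSum_zpow_neg hQ hQ1]
    have hk : Q ^ (-k) ≠ 0 := zpow_ne_zero _ hQ
    have h4 := (summable_thetaTerm_mul_qRecip hQ hQ1 hk).of_norm.hasSum.mul_left (qRecip Q b k)
    refine hasSum_of_pointwise_eq h4 fun l => ?_
    simp only [Function.comp, Equiv.prodComm_apply, Prod.swap]
    have e1 := qRecip_sub hQ 1 l k
    rw [one_mul] at e1
    rw [← e1]
    split_ifs with hkl
    · subst hkl
      simp [qRecip]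
      ring
    · have hk := zpow_ne_zero k hQ
      have hl := zpow_ne_zero l hQ
      have hne : b * Q ^ k ≠ b * Q ^ l := fun h => by
        refine zpow_ne_one_of_norm_lt hQ hQ1 (sub_ne_zero.2 hkl) ?_
        rw [zpow_sub₀ hQ, mul_left_cancel₀ hb h, div_self hl]
      have key := inv_one_sub_mul_two (mul_ne_zero hb hk) (mul_ne_zero hb hl) (hg k) (hg l) hne
      rw [← qRecip_div_sub hQ b b, ← qRecip_div_sub hQ b b, div_self hb] at key
      simp only [qRecip, hkl, if_false] at key ⊢
      linear_combination thetaTerm Q l * key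
  have h5 := (h1'.add h2').add h3'
  have h6 : ∀ x y z : ℂ, y + z + (x - y - z) = x := fun x y z => by ring
  rw [h6] at h5
  refine hasSum_of_pointwise_eq h5 fun l => ?_
  have := qRecip_eq_one_add (hg l)
  linear_combination -thetaTerm Q l * qRecip Q b l * this

/-- The three-term relation for cubic Appell sums with one entry at the pole. -/
theorem appellSum_mul_cubeAppell_one {Q b c : ℂ} (hQ : Q ≠ 0) (hQ1 : ‖Q‖ < 1) (hb : b ≠ 0)
    (hc : c ≠ 0) (gb : QGeneric Q b) (gc : QGeneric Q c) (gbc : QGeneric Q (b / c)) :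
    appellSum Q b * appellSum Q c * (cubeAppell Q 1 (b * c)⁻¹ + qRecipSum Q b + qRecipSum Q c) +
      appellSum Q b⁻¹ * appellSum Q (c / b) * cubeAppell Q b (b ^ 2 / c) +
      appellSum Q c⁻¹ * appellSum Q (b / c) * cubeAppell Q c (c ^ 2 / b) = 0 := by
  have s : ∀ c, c ≠ 0 → Summable fun k => ‖thetaTerm Q k * qRecip Q c k‖ :=
    fun c hc => summable_thetaTerm_mul_qRecip hQ hQ1 hc
  have e : ∀ a b c : ℂ, a ≠ 0 → b ≠ 0 → c ≠ 0 →
      (∑' k, thetaTerm Q k ^ 3 * qRecip Q a k * ((b / a) * (c / a)) ^ (-k)) =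
      cubeAppell Q a (a ^ 2 / (b * c)) := fun a b c ha hb hc => tsum_congr fun k => by
    rw [show a ^ 2 / (b * c) = ((b / a) * (c / a))⁻¹ by field_simp, inv_zpow, zpow_neg]
    ring
  have h1 : (1 : ℂ) ≠ 0 := one_ne_zero
  have gab : QGeneric Q (1 / b) := by simpa using gb.inv
  have gac : QGeneric Q (1 / c) := by simpa using gc.inv
  have H1 := hasSum_thetaTerm_triple hQ hQ1 (div_ne_zero hb h1) (div_ne_zero hc h1) gab.div_symm
    gac.div_symm (s 1 h1)
  have H2 := (tripleSecond.hasSum_iff).2 (hasSum_thetaTerm_triple hQ hQ1 (div_ne_zero h1 hb)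
    (div_ne_zero hc hb) gab gbc.div_symm (s b hb))
  have H3 := (tripleThird.hasSum_iff).2 (hasSum_thetaTerm_triple hQ hQ1 (div_ne_zero h1 hc)
    (div_ne_zero hb hc) gac gbc (s c hc))
  have V : ∀ c, c ≠ 0 → QGeneric Q c → Summable fun l =>
      ‖thetaTerm Q l * (c * Q ^ l * qRecip Q c l ^ 2)‖ := fun c hc hg =>
    (hasSum_appellSum_mul_qRecipSum hQ hQ1 hc hg).summable.norm
  have V' : ∀ c, c ≠ 0 → QGeneric Q c → ∑' l, thetaTerm Q l * (c * Q ^ l * qRecip Q c l ^ 2) =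
      appellSum Q c * qRecipSum Q c := fun c hc hg =>
    (hasSum_appellSum_mul_qRecipSum hQ hQ1 hc hg).tsum_eq
  have D : Summable fun k : ℤ => ‖(if k = 0 then 1 else 0 : ℂ)‖ :=
    (hasSum_ite_eq (0 : ℤ) (1 : ℂ)).summable.norm
  have D' : ∑' k : ℤ, (if k = 0 then 1 else 0 : ℂ) = 1 := tsum_ite_eq _ _
  have H4 := hasSum_triple_mul D (V b hb gb) (s c hc)
  have H5 := hasSum_triple_mul D (s b hb) (V c hc gc)
  have H := (((H1.add H2).add H3).add H4).add H5
  rw [e 1 b c h1 hb hc, e b 1 c hb h1 hc, e c 1 b hc h1 hb, V' b hb gb, V' c hc gc, D'] at H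
  have H0 := hasSum_triple_mul (s 1 h1) (s b hb) (s c hc)
  have key := H.unique (hasSum_of_pointwise_eq H0 fun p => ?_)
  · rw [show ∑' k, thetaTerm Q k * qRecip Q 1 k = 0 from appellSum_one hQ] at key
    have ht : ∀ c, ∑' k, thetaTerm Q k * qRecip Q c k = appellSum Q c := fun c => rfl
    simp only [one_mul, zero_mul, div_one, one_div, one_pow, ht] at key
    linear_combination key
  · obtain ⟨k, l, m⟩ := p
    have hk := zpow_ne_zero k hQ
    have hl := zpow_ne_zero l hQ
    have hm := zpow_ne_zero m hQ
    simp only [tripleSecond, tripleThird, Function.comp, Equiv.coe_fn_mk, qRecip_div_sub hQ]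
    simp only [qRecip]
    split_ifs with h
    · subst h
      have key := inv_one_sub_degenerate (mul_ne_zero hb hl) (mul_ne_zero hc hm)
        (gb l) (gc m) (gbc.mul_zpow_ne hQ hc l m)
      simp only [zpow_zero, mul_one, sub_self, inv_zero, thetaTerm_zero, mul_zero, zero_mul,
        zero_add, one_mul]
      linear_combination (thetaTerm Q l * thetaTerm Q m) * key
    · have key := inv_one_sub_mul_three (mul_ne_zero h1 hk) (mul_ne_zero hb hl)
        (mul_ne_zero hc hm) (by
          rw [one_mul]
          exact zpow_ne_one_of_norm_lt hQ hQ1 h) (gb l) (gc m) (gab.mul_zpow_ne hQ hb k l)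
        (gac.mul_zpow_ne hQ hc k m) (gbc.mul_zpow_ne hQ hc l m)
      linear_combination (-thetaTerm Q k * thetaTerm Q l * thetaTerm Q m) * key

/-- The level-zero Appell series `∑ x^k / (1 - a Q^k)`. -/
noncomputable def kroneckerSum (Q a x : ℂ) : ℂ := ∑' k : ℤ, x ^ k * qRecip Q a k

theorem summable_kroneckerSum {Q a x : ℂ} (hQ : Q ≠ 0) (hQ1 : ‖Q‖ < 1) (ha : a ≠ 0)
    (hx : ‖Q‖ < ‖x‖) (hx1 : ‖x‖ < 1) : Summable fun k : ℤ => ‖x ^ k * qRecip Q a k‖ := by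
  have hx0 : x ≠ 0 := by
    rintro rfl
    exact (norm_nonneg Q).not_gt (by simpa using hx)
  obtain ⟨M, hM⟩ := exists_norm_qRecip_le hQ hQ1 ha
  obtain ⟨M', hM'⟩ := exists_norm_qRecip_le hQ hQ1 (inv_ne_zero ha)
  refine Summable.of_nat_of_neg ?_ ?_
  · refine Summable.of_nonneg_of_le (fun k => norm_nonneg _) (fun k => ?_)
      ((summable_geometric_of_lt_one (norm_nonneg x) hx1).mul_left M)
    rw [norm_mul, zpow_natCast, norm_pow, mul_comm]
    exact mul_le_mul_of_nonneg_right (hM _) (by positivity)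
  · have h1 : ‖Q‖ / ‖x‖ < 1 := (div_lt_one (norm_pos_iff.2 hx0)).2 hx
    refine Summable.of_nonneg_of_le (fun k => norm_nonneg _) (fun k => ?_)
      ((summable_geometric_of_lt_one (by positivity) h1).mul_left (‖a‖⁻¹ * M'))
    have h := qRecip_inv_neg hQ (inv_ne_zero ha) (k : ℤ)
    rw [inv_inv] at h
    rw [h, norm_mul, norm_mul, norm_neg, norm_mul, zpow_neg, zpow_natCast, zpow_natCast, norm_inv,
      norm_inv, norm_pow, norm_pow, div_pow]
    have h2 : (‖x‖ ^ k)⁻¹ * (‖a‖⁻¹ * ‖Q‖ ^ k * ‖qRecip Q a⁻¹ k‖) =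
        ‖a‖⁻¹ * ‖qRecip Q a⁻¹ k‖ * (‖Q‖ ^ k / ‖x‖ ^ k) := by
      field_simp
    rw [h2]
    gcongr
    exact hM' _

theorem summable_mul_pow_succ_mul_succ {Q x : ℂ} (hQ1 : ‖Q‖ < 1) (hx : ‖Q‖ < ‖x‖)
    (hx1 : ‖x‖ < 1) : Summable fun p : ℕ × ℕ => x ^ p.2 * (x⁻¹) ^ p.1 *
      Q ^ ((p.1 + 1) * (p.2 + 1)) := by
  have hx0 : 0 < ‖x‖ := (norm_nonneg Q).trans_lt hx
  have h1 : ‖Q‖ / ‖x‖ < 1 := (div_lt_one hx0).2 hx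
  have hs := (summable_geometric_of_lt_one (by positivity) h1).mul_of_nonneg
    (summable_geometric_of_lt_one hx0.le hx1) (fun k => by positivity) (fun k => by positivity)
  refine Summable.of_norm_bounded hs fun ⟨i, j⟩ => ?_
  have h2 : ‖Q‖ ^ ((i + 1) * (j + 1)) ≤ ‖Q‖ ^ i :=
    pow_le_pow_of_le_one (norm_nonneg _) hQ1.le (by nlinarith)
  simp only [norm_mul, norm_pow, norm_inv, div_pow]
  calc ‖x‖ ^ j * ‖x‖⁻¹ ^ i * ‖Q‖ ^ ((i + 1) * (j + 1)) ≤ ‖x‖ ^ j * ‖x‖⁻¹ ^ i * ‖Q‖ ^ i := by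
        gcongr
    _ = ‖Q‖ ^ i / ‖x‖ ^ i * ‖x‖ ^ j := by
        rw [inv_pow]
        ring

theorem kroneckerSum_inv_self {Q x : ℂ} (hQ : Q ≠ 0) (hQ1 : ‖Q‖ < 1) (hx : ‖Q‖ < ‖x‖)
    (hx1 : ‖x‖ < 1) : kroneckerSum Q x⁻¹ x = 0 := by
  have hx0' : 0 < ‖x‖ := (norm_nonneg Q).trans_lt hx
  have hx0 : x ≠ 0 := norm_pos_iff.1 hx0'
  have hone : x ≠ 1 := by
    rintro rfl
    simp at hx1
  have hs := (summable_mul_pow_succ_mul_succ hQ1 hx hx1).hasSum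
  have hs' := (Equiv.prodComm ℕ ℕ).hasSum_iff.2 hs
  set S := ∑' p : ℕ × ℕ, x ^ p.2 * (x⁻¹) ^ p.1 * Q ^ ((p.1 + 1) * (p.2 + 1))
  have hQn : ∀ n : ℕ, ‖Q ^ (n + 1)‖ ≤ ‖Q‖ := fun n => by
    rw [norm_pow]
    exact pow_le_of_le_one (norm_nonneg _) hQ1.le n.succ_ne_zero
  have hneg : HasSum (fun n : ℕ => x ^ (-((n : ℤ) + 1)) * qRecip Q x⁻¹ (-((n : ℤ) + 1))) (-S) := by
    refine HasSum.prod_fiberwise hs.neg fun n => ?_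
    have hlt : ‖x * Q ^ (n + 1)‖ < 1 := by
      rw [norm_mul]
      nlinarith [hQn n, norm_nonneg (Q ^ (n + 1))]
    have hn := (hasSum_geometric_of_norm_lt_one hlt).mul_left (-(x⁻¹ ^ n * Q ^ (n + 1)))
    have hr := qRecip_inv_neg hQ hx0 ((n : ℤ) + 1)
    have e : x ^ (-((n : ℤ) + 1)) * qRecip Q x⁻¹ (-((n : ℤ) + 1)) =
        -(x⁻¹ ^ n * Q ^ (n + 1)) * (1 - x * Q ^ (n + 1))⁻¹ := by
      rw [hr, qRecip, zpow_neg, zpow_add_one₀ hx0, ← Nat.cast_succ, zpow_natCast, zpow_natCast,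
        inv_pow]
      field_simp
    rw [e]
    refine hasSum_of_pointwise_eq hn fun i => ?_
    simp only [mul_pow]
    ring
  have hpos : HasSum (fun n : ℕ => x ^ (n : ℤ) * qRecip Q x⁻¹ n) S := by
    have h1 : HasSum (fun n : ℕ => x ^ n * Q ^ (n + 1) * (1 - x⁻¹ * Q ^ (n + 1))⁻¹) S := by
      refine HasSum.prod_fiberwise hs' fun n => ?_
      have hlt : ‖x⁻¹ * Q ^ (n + 1)‖ < 1 := by
        rw [norm_mul, norm_inv, inv_mul_lt_one₀ hx0']
        exact (hQn n).trans_lt hx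
      have hn := (hasSum_geometric_of_norm_lt_one hlt).mul_left (x ^ n * Q ^ (n + 1))
      refine hasSum_of_pointwise_eq hn fun i => ?_
      simp only [Function.comp, Equiv.prodComm_apply, Prod.swap, mul_pow]
      ring
    have h2 := h1.add ((hasSum_geometric_of_norm_lt_one hx1).mul_left x)
    have h3 := (hasSum_nat_add_iff (f := fun n : ℕ => x ^ (n : ℤ) * qRecip Q x⁻¹ n) 1).1
      (hasSum_of_pointwise_eq h2 fun n => ?_)
    · have e : x * (1 - x)⁻¹ + (1 - x⁻¹)⁻¹ = 0 := by
        have h4 := sub_ne_zero.2 hone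
        have h5 := sub_ne_zero.2 hone.symm
        have h6 : 1 - x⁻¹ = (x - 1) / x := by field_simp
        rw [h6, inv_div, ← neg_sub x 1]
        field_simp
        ring
      simp only [Finset.sum_range_one, Nat.cast_zero, qRecip, zpow_zero, mul_one, one_mul,
        add_assoc, e, add_zero] at h3
      exact h3
    · have hlt : x⁻¹ * Q ^ (((n + 1 : ℕ)) : ℤ) ≠ 1 := fun h => by
        have h5 : Q ^ (n + 1) = x := by
          rw [zpow_natCast] at h
          field_simp at h
          exact h
        exact ((hQn n).trans_lt hx).ne (congrArg norm h5)
      have h4 := qRecip_eq_one_add hlt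
      have h5 : x⁻¹ * x = 1 := inv_mul_cancel₀ hx0
      rw [zpow_natCast] at h4 ⊢
      rw [h4, qRecip, zpow_natCast]
      linear_combination x ^ n * Q ^ (n + 1) * (1 - x⁻¹ * Q ^ (n + 1))⁻¹ * h5
  have := HasSum.of_nat_of_neg_add_one (f := fun k : ℤ => x ^ k * qRecip Q x⁻¹ k) hpos hneg
  rw [kroneckerSum, this.tsum_eq, add_neg_cancel]

/-- The product formula for the level-zero Appell series. -/
theorem kroneckerSum_mul_appellSum {Q a x : ℂ} (hQ : Q ≠ 0) (hQ1 : ‖Q‖ < 1) (ha : a ≠ 0)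
    (hx : ‖Q‖ < ‖x‖) (hx1 : ‖x‖ < 1) (gx : QGeneric Q x) (ga : QGeneric Q a)
    (gax : QGeneric Q (a * x)) :
    kroneckerSum Q a x * appellSum Q (a * x) = appellSum Q a * appellSum Q x := by
  have hx0 : x ≠ 0 := norm_pos_iff.1 ((norm_nonneg Q).trans_lt hx)
  have hax := mul_ne_zero ha hx0
  have hF := summable_kroneckerSum hQ hQ1 ha hx hx1
  have hu := summable_thetaTerm_mul_qRecip hQ hQ1 hax
  have h0 := (hF.mul_norm hu).of_norm.hasSum
  rw [← tsum_mul_tsum_of_summable_norm hF hu] at h0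
  have hF' := summable_kroneckerSum hQ hQ1 (inv_ne_zero hx0) hx hx1
  have hu' := summable_norm_mul_of_bounded (summable_thetaTerm_mul_zpow hQ hQ1 hx0)
    (exists_norm_qRecip_le hQ hQ1 hax)
  have h1 := (hF'.mul_norm hu').of_norm.hasSum
  rw [← tsum_mul_tsum_of_summable_norm hF' hu',
    show ∑' k, x ^ k * qRecip Q x⁻¹ k = 0 from kroneckerSum_inv_self hQ hQ1 hx hx1, zero_mul,
    ← (Equiv.prodComm ℤ ℤ).hasSum_iff,
    ← (Equiv.prodShear (Equiv.refl ℤ) fun l : ℤ => Equiv.subRight l).hasSum_iff,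
    ← (Equiv.prodComm ℤ ℤ).hasSum_iff] at h1
  have h2 := (h0.sub h1).prod_fiberwise (g := fun k => thetaTerm Q k * qRecip Q a k *
    appellSum Q x) fun k => ?_
  · rw [sub_zero] at h2
    exact h2.unique ((summable_thetaTerm_mul_qRecip hQ hQ1 ha).of_norm.hasSum.mul_right _)
  · have hk := zpow_ne_zero k hQ
    have hxk := zpow_ne_zero k hx0
    have h3 := (summable_thetaTerm_mul_qRecip hQ hQ1
      (mul_ne_zero hx0 (zpow_ne_zero (-k) hQ))).of_norm.hasSum.mul_left (x ^ k * qRecip Q a k)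
    rw [show ∑' l, thetaTerm Q l * qRecip Q (x * Q ^ (-k)) l = appellSum Q (x * Q ^ (-k)) from rfl,
      appellSum_mul_zpow_neg hQ hQ1 hx0 gx] at h3
    have e : x ^ k * qRecip Q a k * (thetaTerm Q k * x ^ (-k) * appellSum Q x) =
        thetaTerm Q k * qRecip Q a k * appellSum Q x := by
      rw [zpow_neg]
      field_simp
    rw [e] at h3
    refine hasSum_of_pointwise_eq h3 fun l => ?_
    have hl := zpow_ne_zero l hQ
    have hne : a * Q ^ k ≠ a * x * Q ^ l := QGeneric.mul_zpow_ne hQ hax (by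
      rw [div_mul_cancel_left₀ ha]
      exact gx.inv) k l
    have key := inv_one_sub_mul_two (mul_ne_zero ha hk) (mul_ne_zero hax hl) (ga k) (gax l) hne
    rw [← qRecip_div_sub hQ, ← qRecip_div_sub hQ, mul_div_cancel_left₀ _ ha,
      div_mul_cancel_left₀ ha] at key
    simp only [Function.comp, Equiv.prodComm_apply, Prod.swap, Equiv.prodShear_apply,
      Equiv.refl_apply, Equiv.subRight_apply]
    rw [← qRecip_sub hQ, zpow_sub₀ hx0]
    have hxl := zpow_ne_zero l hx0
    have e2 : x ^ k / x ^ l * x ^ l = x ^ k := div_mul_cancel₀ _ hxl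
    change qRecip Q a k * qRecip Q (a * x) l = qRecip Q a k * _ + qRecip Q (a * x) l * _ at key
    linear_combination x ^ k * thetaTerm Q l * key - qRecip Q x⁻¹ (k - l) * thetaTerm Q l *
      qRecip Q (a * x) l * e2

theorem inv_one_sub_mul_inv_one_sub {C D : ℂ} (hD : D ≠ 1) (hC : C ≠ 1) (hDC : D * C ≠ 1) :
    (1 - D)⁻¹ * (1 - C)⁻¹ = (1 - D * C)⁻¹ * ((1 - C)⁻¹ + D * (1 - D)⁻¹) := by
  have h1 := sub_ne_zero.2 hD.symm
  have h2 := sub_ne_zero.2 hC.symm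
  have h3 := sub_ne_zero.2 hDC.symm
  field_simp
  ring

theorem hasSum_kroneckerSum_mul {Q b c x : ℂ} (hQ : Q ≠ 0) (hQ1 : ‖Q‖ < 1) (hb : b ≠ 0)
    (hc : c ≠ 0) (hx : ‖Q‖ < ‖x‖) (hx1 : ‖x‖ < 1) (gb : QGeneric Q b) (gc : QGeneric Q c)
    (gbc : QGeneric Q (b / c)) :
    HasSum (fun n : ℤ => x ^ n * qRecip Q b n * (qRecipSum Q c - qRecipSum Q (c / b) + n))
      (kroneckerSum Q (b / c) x * kroneckerSum Q c x) := by
  have hx0 : x ≠ 0 := norm_pos_iff.1 ((norm_nonneg Q).trans_lt hx)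
  have h1 := summable_kroneckerSum hQ hQ1 (div_ne_zero hb hc) hx hx1
  have h2 := summable_kroneckerSum hQ hQ1 hc hx hx1
  have h := (h1.mul_norm h2).of_norm.hasSum
  rw [← tsum_mul_tsum_of_summable_norm h1 h2, ← (Equiv.prodComm ℤ ℤ).hasSum_iff,
    ← (Equiv.prodShear (Equiv.refl ℤ) fun l : ℤ => Equiv.subRight l).hasSum_iff,
    ← (Equiv.prodComm ℤ ℤ).hasSum_iff] at h
  refine h.prod_fiberwise fun n => ?_
  have hcb := div_ne_zero hc hb
  have h3 := (Equiv.subRight n).hasSum_iff.2 (summable_qRecip_sub hQ hQ1 hcb).of_norm.hasSum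
  have h4 := (((summable_qRecip_sub hQ hQ1 hc).of_norm.hasSum.sub h3).add
    (hasSum_nonnegInd_sub (-n))).mul_left (x ^ n * qRecip Q b n)
  have e : -((-n : ℤ) : ℂ) = n := by
    push_cast
    ring
  rw [e] at h4
  refine hasSum_of_pointwise_eq h4 fun l => ?_
  simp only [Function.comp, Equiv.prodComm_apply, Prod.swap, Equiv.prodShear_apply,
      Equiv.refl_apply, Equiv.subRight_apply]
  have hl := zpow_ne_zero l hQ
  have k1 := qRecip_inv_neg hQ (div_ne_zero hb hc) (n - l)
  have k2 : b / c * Q ^ (n - l) * (c * Q ^ l) = b * Q ^ n := by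
    rw [zpow_sub₀ hQ]
    field_simp
  have k3 := inv_one_sub_mul_inv_one_sub (gbc (n - l)) (gc l) (k2 ▸ gb n)
  have k4 : x ^ (n - l) * x ^ l = x ^ n := by
    rw [← zpow_add₀ hx0, sub_add_cancel]
  rw [inv_div, neg_sub] at k1
  rw [k2] at k3
  rw [k1, ← sub_eq_add_neg l n, ← k4]
  simp only [qRecip]
  linear_combination x ^ (n - l) * x ^ l * k3

theorem qRecipSum_mul_kroneckerSum {Q b c x : ℂ} (hQ : Q ≠ 0) (hQ1 : ‖Q‖ < 1) (hb : b ≠ 0)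
    (hc : c ≠ 0) (hx : ‖Q‖ < ‖x‖) (hx1 : ‖x‖ < 1) (gb : QGeneric Q b) (gc : QGeneric Q c)
    (gx : QGeneric Q x) (gbc : QGeneric Q (b / c)) (gbx : QGeneric Q (b * x)) :
    (qRecipSum Q c - qRecipSum Q (c / b) - qRecipSum Q x⁻¹ + qRecipSum Q (b * x)⁻¹) *
      kroneckerSum Q b x = kroneckerSum Q (b / c) x * kroneckerSum Q c x := by
  have hx0 : x ≠ 0 := norm_pos_iff.1 ((norm_nonneg Q).trans_lt hx)
  have h1 := hasSum_kroneckerSum_mul hQ hQ1 hb hc hx hx1 gb gc gbc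
  have h2 := hasSum_kroneckerSum_mul hQ hQ1 hb (inv_ne_zero hx0) hx hx1 gb gx.inv
    (by simpa using gbx)
  rw [kroneckerSum_inv_self hQ hQ1 hx hx1, mul_zero] at h2
  have h3 := h1.sub h2
  rw [sub_zero] at h3
  refine HasSum.unique ?_ h3
  refine hasSum_of_pointwise_eq
    ((summable_kroneckerSum hQ hQ1 hb hx hx1).of_norm.hasSum.mul_left _) fun n => ?_
  rw [mul_inv, div_eq_mul_inv x⁻¹, mul_comm b⁻¹]
  ring

theorem tsum_int_eq_sum_five {f : ℤ → ℂ} (hf : Summable f) (a : ℤ) :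
    ∑' n, f n = (∑' k, f (5 * k + a)) + (∑' k, f (5 * k + (a + 1))) + (∑' k, f (5 * k + (a + 2))) +
      (∑' k, f (5 * k + (a + 3))) + ∑' k, f (5 * k + (a + 4)) := by
  have h := hf.hasSum
  rw [← (Equiv.addRight a).hasSum_iff, ← (Int.divModEquiv 5).symm.hasSum_iff,
    ← (Equiv.prodComm _ _).hasSum_iff] at h
  have h1 := h.prod_fiberwise fun m => (h.summable.prod_factor m).hasSum
  have h2 := h1.unique (hasSum_fintype _)
  rw [Fin.sum_univ_five] at h2
  rw [h2]
  have e : ∀ (m : Fin 5) (k : ℤ), (((f ∘ Equiv.addRight a) ∘ (Int.divModEquiv 5).symm) ∘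
      Equiv.prodComm (Fin 5) ℤ) (m, k) = f (5 * k + (a + (m : ℕ))) := fun m k => by
    simp only [Function.comp, Equiv.prodComm_apply, Prod.swap, Equiv.coe_addRight,
      Int.divModEquiv_symm_apply]
    congr 1
    push_cast
    ring
  simp only [e]
  simp

theorem thetaTerm_five_mul_add {q : ℂ} (hq : q ≠ 0) (k m : ℤ) :
    thetaTerm q (5 * k + m) ^ 3 =
      thetaTerm q m ^ 3 * (thetaTerm ((q ^ 5) ^ 5) k ^ 3 * ((q ^ 5) ^ (3 * m - 6)) ^ k) := by
  have h : thetaTerm q (5 * k) = thetaTerm ((q ^ 5) ^ 5) k * q ^ (-10 * k) := by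
    unfold thetaTerm
    rw [zpow_mul (-1 : ℂ) 5 k, ← pow_mul, ← zpow_natCast q (5 * 5), ← zpow_mul q,
      mul_assoc ((-1 : ℂ) ^ k), ← zpow_add₀ hq]
    have h1 := two_mul_triangle k
    have h2 := two_mul_triangle (5 * k)
    congr 2
    · norm_num
    · push_cast
      linarith
  rw [thetaTerm_add hq, h]
  have h3 : ((q ^ 5) ^ (3 * m - 6)) ^ k = (q ^ (-10 * k) * q ^ (5 * k * m)) ^ 3 := by
    rw [← zpow_add₀ hq, ← zpow_natCast q 5, ← zpow_mul, ← zpow_mul, ← zpow_natCast, ← zpow_mul]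
    congr 1
    push_cast
    ring
  rw [h3]
  ring

/-- The series governing the number of partitions with rank in a given class modulo five. -/
noncomputable def rankAppell (q z : ℂ) : ℂ :=
  ∑' n : ℤ, thetaTerm q n ^ 3 * z ^ n * qRecip (q ^ 5) 1 n

theorem summable_thetaTerm_cube_mul_zpow {Q : ℂ} (hQ : Q ≠ 0) (hQ1 : ‖Q‖ < 1) {c : ℂ}
    (hc : c ≠ 0) : Summable fun k : ℤ => ‖thetaTerm Q k ^ 3 * c ^ k‖ := by
  have h := summable_thetaTerm hQ hQ1
  have hb : ∃ M, ∀ k : ℤ, ‖thetaTerm Q k‖ ≤ M :=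
    ⟨_, fun k => h.le_tsum k fun _ _ => norm_nonneg _⟩
  refine (summable_norm_mul_of_bounded (summable_norm_mul_of_bounded
    (summable_thetaTerm_mul_zpow hQ hQ1 hc) hb) hb).congr fun k => ?_
  congr 1
  ring

theorem cubeTheta_one_eq_sum_five {q : ℂ} (hq : q ≠ 0) (hq1 : ‖q‖ < 1) (a : ℤ) :
    let y := q ^ 5
    let g := fun m : ℤ => thetaTerm q m ^ 3 * q⁻¹ ^ m * cubeTheta (y ^ 5) (y ^ (3 * m - 2))
    cubeTheta q 1 = g a + g (a + 1) + g (a + 2) + g (a + 3) + g (a + 4) := by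
  intro y g
  have hy : y ≠ 0 := pow_ne_zero _ hq
  have hs := (summable_thetaTerm_cube_mul_zpow hq hq1 (inv_ne_zero hq)).of_norm
  have key : ∀ m : ℤ, ∑' k : ℤ, thetaTerm q (5 * k + m) ^ 3 * q⁻¹ ^ (5 * k + m) = g m :=
    fun m => by
      simp only [g, cubeTheta]
      rw [← tsum_mul_left]
      refine tsum_congr fun k => ?_
      have h1 : q⁻¹ ^ (5 * k) = (y⁻¹) ^ k := by
        rw [zpow_mul, zpow_ofNat, ← inv_pow]
      have h2 : (y ^ (3 * m - 2)) ^ k = (y ^ (3 * m - 6)) ^ k * (y ^ k) ^ 4 := by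
        rw [← zpow_natCast, ← zpow_mul, ← zpow_mul, ← zpow_mul, ← zpow_add₀ hy]
        congr 1
        push_cast
        ring
      have h3 : (y ^ 5) ^ (-k) = (y ^ k)⁻¹ ^ 5 := by
        rw [zpow_neg, inv_pow, ← zpow_natCast, ← zpow_natCast, ← zpow_mul, ← zpow_mul, mul_comm]
      have h0 : thetaTerm q (5 * k + m) ^ 3 = thetaTerm q m ^ 3 *
          (thetaTerm (y ^ 5) k ^ 3 * (y ^ (3 * m - 6)) ^ k) := thetaTerm_five_mul_add hq k m
      have hk := zpow_ne_zero k hy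
      rw [h0, zpow_add₀ (inv_ne_zero hq), h1, h2, h3, inv_zpow y]
      field_simp
  rw [cubeTheta, ← key, ← key, ← key, ← key, ← key, ← tsum_int_eq_sum_five hs]
  refine tsum_congr fun k => ?_
  rw [inv_zpow, zpow_neg, one_zpow, mul_one]

theorem rankAppell_eq_sum_five {q : ℂ} (hq : q ≠ 0) (hq1 : ‖q‖ < 1) (b : ℕ) (a : ℤ) :
    let y := q ^ 5
    let g := fun m : ℤ => thetaTerm q m ^ 3 * (q ^ b) ^ m *
      cubeAppell (y ^ 5) (y ^ m) (y ^ (3 * m - 6 + b))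
    rankAppell q (q ^ b) = g a + g (a + 1) + g (a + 2) + g (a + 3) + g (a + 4) := by
  intro y g
  have hy : y ≠ 0 := pow_ne_zero _ hq
  have hy1 : ‖y‖ < 1 := by
    rw [norm_pow]
    exact pow_lt_one₀ (norm_nonneg _) hq1 (by norm_num)
  have hs := (summable_norm_mul_of_bounded (summable_thetaTerm_cube_mul_zpow hq hq1
    (pow_ne_zero b hq)) (exists_norm_qRecip_le hy hy1 one_ne_zero)).of_norm
  have key : ∀ m : ℤ, ∑' k : ℤ, thetaTerm q (5 * k + m) ^ 3 * (q ^ b) ^ (5 * k + m) *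
      qRecip (q ^ 5) 1 (5 * k + m) = g m := fun m => by
    simp only [g, cubeAppell]
    rw [← tsum_mul_left]
    refine tsum_congr fun k => ?_
    have h1 : qRecip (q ^ 5) 1 (5 * k + m) = qRecip (y ^ 5) (y ^ m) k := by
      rw [qRecip, qRecip, one_mul, zpow_add₀ hy, mul_comm, zpow_mul]
      rfl
    have h2 : (q ^ b) ^ (5 * k + m) = (q ^ b) ^ m * (y ^ b) ^ k := by
      rw [zpow_add₀ (pow_ne_zero b hq), mul_comm, zpow_mul]
      congr 2
      rw [← pow_mul, ← zpow_natCast, ← zpow_natCast, ← zpow_mul, Nat.cast_mul, mul_comm (b : ℤ)]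
      rfl
    rw [thetaTerm_five_mul_add hq, h1, h2, zpow_add₀ hy, mul_zpow, zpow_natCast]
    ring
  rw [rankAppell, ← key, ← key, ← key, ← key, ← key, ← tsum_int_eq_sum_five hs]

theorem cubeTheta_inv {Q x : ℂ} (hQ : Q ≠ 0) : cubeTheta Q (Q⁻¹ * x⁻¹) = cubeTheta Q x := by
  unfold cubeTheta
  rw [← (Equiv.neg ℤ).tsum_eq fun k => thetaTerm Q k ^ 3 * Q ^ (-k) * x ^ k]
  refine tsum_congr fun k => ?_
  have hk := zpow_ne_zero k hQ
  simp only [Equiv.neg_apply]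
  rw [thetaTerm_neg hQ, mul_zpow, inv_zpow, inv_zpow, neg_neg, zpow_neg, zpow_neg]
  field_simp

theorem cubeTheta_mul_pow_three {Q x : ℂ} (hQ : Q ≠ 0) (hx : x ≠ 0) :
    cubeTheta Q x = -Q ^ 2 * x * cubeTheta Q (x * Q ^ 3) := by
  unfold cubeTheta
  rw [← (Equiv.addRight (1 : ℤ)).tsum_eq fun k => thetaTerm Q k ^ 3 * Q ^ (-k) * x ^ k,
    ← tsum_mul_left]
  refine tsum_congr fun k => ?_
  have hk := zpow_ne_zero k hQ
  have e : (Q ^ 3) ^ k = (Q ^ k) ^ 3 := by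
    rw [← zpow_natCast, ← zpow_natCast, ← zpow_mul, ← zpow_mul, mul_comm]
  simp only [Equiv.coe_addRight]
  rw [thetaTerm_add_one hQ, zpow_neg, zpow_neg, zpow_add_one₀ hQ, zpow_add_one₀ hx, mul_zpow, e]
  field_simp

theorem appellSum_sq_mul_cubeTheta {Q z : ℂ} (hQ : Q ≠ 0) (hQ1 : ‖Q‖ < 1) (hz : z ≠ 0)
    (gz : QGeneric Q z) (gz2 : QGeneric Q (z ^ 2)) (hu : appellSum Q z ≠ 0) :
    appellSum Q (z ^ 2) * (z * cubeTheta Q (z ^ 3) + cubeTheta Q (z ^ 3)⁻¹) =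
      appellSum Q z * cubeTheta Q 1 := by
  have h := appellSum_mul_cubeTheta_add hQ hQ1 hz one_ne_zero (inv_ne_zero hz)
    (by simpa using gz) (by simpa [sq] using gz2) (by simpa using gz)
  have e1 : z⁻¹ / z = (z ^ 2)⁻¹ := by field_simp
  have e2 : z / z⁻¹ = z ^ 2 := by field_simp
  have e3 : z ^ 2 / (1 * z⁻¹) = z ^ 3 := by field_simp
  have e4 : 1 ^ 2 / (z * z⁻¹) = 1 := by field_simp
  have e5 : z⁻¹ ^ 2 / (z * 1) = (z ^ 3)⁻¹ := by field_simp
  rw [e1, e2, e3, e4, e5, one_div, div_one, one_div, inv_inv, div_one,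
    appellSum_inv hQ hz, appellSum_inv hQ (pow_ne_zero 2 hz), inv_one] at h
  have h2 : z * appellSum Q z * (appellSum Q (z ^ 2) * (z * cubeTheta Q (z ^ 3) +
      cubeTheta Q (z ^ 3)⁻¹) - appellSum Q z * cubeTheta Q 1) = 0 := by
    rw [← h]
    field_simp
    ring
  exact sub_eq_zero.1 ((mul_eq_zero.1 h2).resolve_left (mul_ne_zero hz hu))

theorem norm_thetaTerm_natCast_le {Q : ℂ} (hQ : Q ≠ 0) (hQ1 : ‖Q‖ ≤ 1) (n : ℕ) :
    ‖thetaTerm Q n‖ ≤ ‖Q‖ ^ n := by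
  rw [thetaTerm, norm_mul, norm_zpow, norm_zpow, norm_neg, norm_one, one_zpow, one_mul,
    ← zpow_natCast]
  refine zpow_le_zpow_right_of_le_one₀ (norm_pos_iff.2 hQ) hQ1 ?_
  have h := two_mul_triangle n
  rcases Nat.eq_zero_or_pos n with rfl | hn
  · simp
  · nlinarith

theorem norm_inv_one_sub_le {d : ℂ} {r : ℝ} (hr : 0 < r) (hr1 : r ≤ 1 / 8) (hd : r⁻¹ ^ 3 ≤ ‖d‖) :
    ‖(1 - d)⁻¹‖ ≤ r := by
  rw [norm_inv]
  have h8 : 8 ≤ r⁻¹ := by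
    rw [le_inv_comm₀ (by norm_num) hr]
    linarith
  refine inv_le_of_inv_le₀ hr ?_
  have h1 : ‖d‖ - ‖(1 : ℂ)‖ ≤ ‖1 - d‖ := by
    rw [norm_sub_rev]
    exact norm_sub_norm_le _ _
  rw [norm_one] at h1
  nlinarith [mul_self_nonneg (r⁻¹ - 8)]

theorem norm_appellSum_sub_one_lt {y : ℂ} (hy : y ≠ 0) (hy1 : ‖y‖ ≤ 1 / 8) {c : ℂ}
    (hc : ‖c‖ ≤ ‖y‖) (hc2 : ‖y‖ ^ 2 ≤ ‖c‖) : ‖appellSum (y ^ 5) c - 1‖ < 1 := by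
  have hr : 0 < ‖y‖ := norm_pos_iff.2 hy
  have hQ : y ^ 5 ≠ 0 := pow_ne_zero _ hy
  have hQn : ‖y ^ 5‖ = ‖y‖ ^ 5 := norm_pow _ _
  have hQy : ‖y ^ 5‖ ≤ ‖y‖ := by
    rw [hQn]
    exact pow_le_of_le_one hr.le (by linarith) (by norm_num)
  have hQ1 : ‖y ^ 5‖ < 1 := by linarith
  have hc0 : c ≠ 0 := norm_pos_iff.1 (by nlinarith)
  have hpos : ∀ n : ℕ, ‖c * (y ^ 5) ^ (n : ℤ)‖ ≤ ‖y‖ := fun n => by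
    rw [norm_mul, zpow_natCast, norm_pow (y ^ 5)]
    calc ‖c‖ * ‖y ^ 5‖ ^ n ≤ ‖c‖ * 1 := by
          gcongr
          exact pow_le_one₀ (norm_nonneg _) hQ1.le
      _ ≤ ‖y‖ := by linarith
  have hneg : ∀ n : ℕ, ‖qRecip (y ^ 5) c (-(n + 1 : ℤ))‖ ≤ ‖y‖ := fun n => by
    refine norm_inv_one_sub_le hr hy1 ?_
    rw [norm_mul, zpow_neg, norm_inv, norm_zpow, hQn, inv_pow, ← div_eq_mul_inv,
      inv_le_comm₀ (by positivity) (by positivity), inv_div, div_le_iff₀ (by positivity)]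
    calc (‖y‖ ^ 5) ^ (n + 1 : ℤ) ≤ (‖y‖ ^ 5) ^ (1 : ℤ) :=
          zpow_le_zpow_right_of_le_one₀ (by positivity) (by rw [← hQn]; exact hQ1.le) (by omega)
      _ = ‖y‖ ^ 3 * ‖y‖ ^ 2 := by rw [zpow_one]; ring
      _ ≤ ‖y‖ ^ 3 * ‖c‖ := by gcongr
  have hd : ∀ n : ℕ, 7 / 8 ≤ ‖1 - c * (y ^ 5) ^ (n : ℤ)‖ := fun n => by
    have h := norm_sub_norm_le 1 (c * (y ^ 5) ^ (n : ℤ))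
    rw [norm_one] at h
    linarith [hpos n]
  have hs := (summable_thetaTerm_mul_qRecip hQ hQ1 hc0).of_norm.hasSum.nat_add_neg_add_one.sub
    (hasSum_ite_eq 0 (1 : ℂ))
  have hg : HasSum (fun n : ℕ => 3 * ‖y‖ * (1 / 2) ^ n) (3 * ‖y‖ * 2) :=
    hasSum_geometric_two.mul_left _
  have key : ‖appellSum (y ^ 5) c - 1‖ ≤ 3 * ‖y‖ * 2 := by
    rw [appellSum, ← hs.tsum_eq]
    refine tsum_of_norm_bounded hg fun n => ?_
    have hw : thetaTerm (y ^ 5) (-(n + 1 : ℤ)) = -thetaTerm (y ^ 5) n := by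
      rw [← thetaTerm_neg_one_sub hQ]
      congr 1
      ring
    have hr0 : 1 - c * (y ^ 5) ^ (n : ℤ) ≠ 0 := norm_pos_iff.1 (by linarith [hd n])
    rcases Nat.eq_zero_or_pos n with hn | hn
    · have hw0 : thetaTerm (y ^ 5) n = 1 := by
        rw [hn]
        exact thetaTerm_zero _
      have e : thetaTerm (y ^ 5) n * qRecip (y ^ 5) c n + thetaTerm (y ^ 5) (-(n + 1 : ℤ)) *
          qRecip (y ^ 5) c (-(n + 1 : ℤ)) - (if n = 0 then 1 else 0) =
          c * (y ^ 5) ^ (n : ℤ) / (1 - c * (y ^ 5) ^ (n : ℤ)) -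
            qRecip (y ^ 5) c (-(n + 1 : ℤ)) := by
        rw [hw, hw0, if_pos hn, qRecip]
        field_simp
        ring
      rw [e]
      refine (norm_sub_le _ _).trans ?_
      have h1 : ‖c * (y ^ 5) ^ (n : ℤ) / (1 - c * (y ^ 5) ^ (n : ℤ))‖ ≤ 2 * ‖y‖ := by
        rw [norm_div, div_le_iff₀ (by linarith [hd n])]
        nlinarith [hd n, hpos n]
      have h2 := hneg n
      rw [hn, pow_zero, mul_one, ← hn]
      linarith
    · rw [if_neg hn.ne', hw, sub_zero, neg_mul, ← sub_eq_add_neg, ← mul_sub, norm_mul]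
      have h1 : ‖qRecip (y ^ 5) c n‖ ≤ 2 := by
        rw [qRecip, norm_inv]
        exact inv_le_of_inv_le₀ (by norm_num) (by linarith [hd n])
      have h2 : ‖qRecip (y ^ 5) c n - qRecip (y ^ 5) c (-(n + 1 : ℤ))‖ ≤ 3 :=
        (norm_sub_le _ _).trans (by linarith [hneg n])
      have h3 : ‖thetaTerm (y ^ 5) n‖ ≤ ‖y‖ * (1 / 2) ^ n := by
        refine (norm_thetaTerm_natCast_le hQ hQ1.le n).trans ?_
        rw [hQn, ← pow_mul]
        calc ‖y‖ ^ (5 * n) ≤ ‖y‖ ^ (1 + n) :=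
              pow_le_pow_of_le_one hr.le (by linarith) (by omega)
          _ = ‖y‖ * ‖y‖ ^ n := by ring
          _ ≤ ‖y‖ * (1 / 2) ^ n := by gcongr; linarith
      calc _ ≤ ‖y‖ * (1 / 2) ^ n * 3 := by gcongr
        _ = _ := by ring
  linarith

theorem qGeneric_zpow {y : ℂ} (hy : y ≠ 0) (hy1 : ‖y‖ < 1) {j : ℤ} (hj : ¬ (5 : ℤ) ∣ j) :
    QGeneric (y ^ 5) (y ^ j) := fun m => by
  rw [← zpow_natCast, ← zpow_mul, ← zpow_add₀ hy]
  exact zpow_ne_one_of_norm_lt hy hy1 (by push_cast; omega)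

theorem appellSum_zpow_neg_index {y : ℂ} (hy : y ≠ 0) (j : ℤ) :
    appellSum (y ^ 5) (y ^ (-j)) = -y ^ j * appellSum (y ^ 5) (y ^ j) := by
  rw [zpow_neg, appellSum_inv (pow_ne_zero _ hy) (zpow_ne_zero _ hy)]

theorem appellSum_zpow_add_five {y : ℂ} (hy : y ≠ 0) (hy1 : ‖y‖ < 1) {j : ℤ}
    (hj : ¬ (5 : ℤ) ∣ j) :
    appellSum (y ^ 5) (y ^ (j + 5)) = -y ^ j * appellSum (y ^ 5) (y ^ j) := by
  rw [zpow_add₀ hy]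
  exact appellSum_mul_self (pow_ne_zero _ hy) (by
    rw [norm_pow]; exact pow_lt_one₀ (norm_nonneg _) hy1 (by norm_num)) (zpow_ne_zero _ hy)
    (qGeneric_zpow hy hy1 hj)

theorem qRecipSum_zpow_neg_index {y : ℂ} (hy : y ≠ 0) (hy1 : ‖y‖ < 1) {j : ℤ}
    (hj : ¬ (5 : ℤ) ∣ j) :
    qRecipSum (y ^ 5) (y ^ (-j)) = -qRecipSum (y ^ 5) (y ^ j) - 1 := by
  rw [zpow_neg]
  exact qRecipSum_inv (pow_ne_zero _ hy) (by
    rw [norm_pow]; exact pow_lt_one₀ (norm_nonneg _) hy1 (by norm_num)) (zpow_ne_zero _ hy)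
    (qGeneric_zpow hy hy1 hj)

theorem qRecipSum_zpow_add_five {y : ℂ} (hy : y ≠ 0) (hy1 : ‖y‖ < 1) (j : ℤ) :
    qRecipSum (y ^ 5) (y ^ (j + 5)) = qRecipSum (y ^ 5) (y ^ j) + 1 := by
  rw [zpow_add₀ hy]
  exact qRecipSum_mul_self (pow_ne_zero _ hy) (by
    rw [norm_pow]; exact pow_lt_one₀ (norm_nonneg _) hy1 (by norm_num)) (zpow_ne_zero _ hy)

theorem zpow_sq_div {y : ℂ} (hy : y ≠ 0) (i j k : ℤ) :
    (y ^ i) ^ 2 / (y ^ j * y ^ k) = y ^ (2 * i - j - k) := by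
  rw [zpow_sub₀ hy, zpow_sub₀ hy, div_div, two_mul, zpow_add₀ hy, sq]

theorem appellSum_zpow_mul_three {y : ℂ} (hy : y ≠ 0) (hy1 : ‖y‖ < 1) {i j k : ℤ}
    (hi : ¬ (5 : ℤ) ∣ i) (hj : ¬ (5 : ℤ) ∣ j) (hk : ¬ (5 : ℤ) ∣ k) (hij : ¬ (5 : ℤ) ∣ i - j)
    (hik : ¬ (5 : ℤ) ∣ i - k) (hjk : ¬ (5 : ℤ) ∣ j - k) :
    let u := fun m : ℤ => appellSum (y ^ 5) (y ^ m)
    let l := fun m n : ℤ => cubeAppell (y ^ 5) (y ^ m) (y ^ n)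
    u i * u j * u k = u (j - i) * u (k - i) * l i (2 * i - j - k) +
      u (i - j) * u (k - j) * l j (2 * j - i - k) + u (i - k) * u (j - k) * l k (2 * k - i - j) := by
  intro u l
  simp only [u, l, ← zpow_sq_div hy, zpow_sub₀ hy]
  have g := fun {m : ℤ} (hm : ¬ (5 : ℤ) ∣ m) => qGeneric_zpow hy hy1 hm
  have g' := fun {m n : ℤ} (hm : ¬ (5 : ℤ) ∣ m - n) => by
    simpa only [zpow_sub₀ hy] using qGeneric_zpow hy hy1 hm
  exact appellSum_mul_three (pow_ne_zero _ hy) (by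
    rw [norm_pow]; exact pow_lt_one₀ (norm_nonneg _) hy1 (by norm_num)) (zpow_ne_zero _ hy)
    (zpow_ne_zero _ hy) (zpow_ne_zero _ hy) (g hi) (g hj) (g hk) (g' hij) (g' hik) (g' hjk)

theorem appellSum_zpow_mul_cubeAppell_one {y : ℂ} (hy : y ≠ 0) (hy1 : ‖y‖ < 1) {i j : ℤ}
    (hi : ¬ (5 : ℤ) ∣ i) (hj : ¬ (5 : ℤ) ∣ j) (hij : ¬ (5 : ℤ) ∣ i - j) :
    let u := fun m : ℤ => appellSum (y ^ 5) (y ^ m)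
    let l := fun m n : ℤ => cubeAppell (y ^ 5) (y ^ m) (y ^ n)
    let e := fun m : ℤ => qRecipSum (y ^ 5) (y ^ m)
    u i * u j * (l 0 (-(i + j)) + e i + e j) + u (-i) * u (j - i) * l i (2 * i - j) +
      u (-j) * u (i - j) * l j (2 * j - i) = 0 := by
  intro u l e
  have h := appellSum_mul_cubeAppell_one (pow_ne_zero 5 hy) (by
    rw [norm_pow]; exact pow_lt_one₀ (norm_nonneg _) hy1 (by norm_num)) (zpow_ne_zero i hy)
    (zpow_ne_zero j hy) (qGeneric_zpow hy hy1 hi) (qGeneric_zpow hy hy1 hj) (by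
    simpa only [zpow_sub₀ hy] using qGeneric_zpow hy hy1 hij)
  have e1 : ∀ m n : ℤ, y ^ (2 * m - n) = (y ^ m) ^ 2 / y ^ n := fun m n => by
    rw [zpow_sub₀ hy, two_mul, zpow_add₀ hy, sq]
  simp only [u, l, e, e1, zpow_neg, zpow_zero, zpow_add₀ hy, zpow_sub₀ hy]
  exact h

theorem qRecipSum_zpow_mul_appellSum {y : ℂ} (hy : y ≠ 0) (hy1 : ‖y‖ < 1) {i j k : ℤ}
    (hk : 0 < k) (hk5 : k < 5) (hi : ¬ (5 : ℤ) ∣ i) (hj : ¬ (5 : ℤ) ∣ j)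
    (hij : ¬ (5 : ℤ) ∣ i - j) (hik : ¬ (5 : ℤ) ∣ i + k) (hjk : ¬ (5 : ℤ) ∣ j + k)
    (hijk : ¬ (5 : ℤ) ∣ i - j + k) (u : ℤ → ℂ) (hu : u = fun m => appellSum (y ^ 5) (y ^ m))
    (hik0 : u (i + k) ≠ 0) (hjk0 : u (j + k) ≠ 0) (hijk0 : u (i - j + k) ≠ 0) :
    let e := fun m : ℤ => qRecipSum (y ^ 5) (y ^ m)
    (e j - e (j - i) - e (-k) + e (-(i + k))) * (u i * u k / u (i + k)) =
      u (i - j) * u k / u (i - j + k) * (u j * u k / u (j + k)) := by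
  intro e
  have hQ1 : ‖y ^ 5‖ < 1 := by
    rw [norm_pow]; exact pow_lt_one₀ (norm_nonneg _) hy1 (by norm_num)
  have hr : 0 < ‖y‖ := norm_pos_iff.2 hy
  have hx1 : ‖y ^ k‖ < 1 := by
    rw [norm_zpow]
    simpa using zpow_lt_zpow_right_of_lt_one₀ hr hy1 hk
  have hx : ‖y ^ 5‖ < ‖y ^ k‖ := by
    rw [norm_pow, norm_zpow, ← zpow_natCast]
    exact zpow_lt_zpow_right_of_lt_one₀ hr hy1 hk5
  have gk := qGeneric_zpow hy hy1 (j := k) (by omega)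
  have f : ∀ m : ℤ, ¬ (5 : ℤ) ∣ m → ¬ (5 : ℤ) ∣ m + k → u (m + k) ≠ 0 →
      kroneckerSum (y ^ 5) (y ^ m) (y ^ k) = u m * u k / u (m + k) := fun m hm hmk h0 => by
    rw [eq_div_iff h0, hu]
    simp only [zpow_add₀ hy]
    exact kroneckerSum_mul_appellSum (pow_ne_zero _ hy) hQ1 (zpow_ne_zero _ hy)
      hx hx1 gk (qGeneric_zpow hy hy1 hm)
      (by simpa only [zpow_add₀ hy] using qGeneric_zpow hy hy1 hmk)
  rw [← f i hi hik hik0, ← f j hj hjk hjk0, ← f (i - j) hij hijk hijk0]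
  simp only [e, zpow_sub₀ hy, zpow_add₀ hy, zpow_neg]
  exact qRecipSum_mul_kroneckerSum (pow_ne_zero 5 hy) hQ1 (zpow_ne_zero i hy) (zpow_ne_zero j hy)
    hx hx1 (qGeneric_zpow hy hy1 hi) (qGeneric_zpow hy hy1 hj) gk
    (by simpa only [zpow_sub₀ hy] using qGeneric_zpow hy hy1 hij)
    (by simpa only [zpow_add₀ hy] using qGeneric_zpow hy hy1 hik)

/-- The values of `appellSum (y ^ 5)` and `qRecipSum (y ^ 5)` at powers of `y`. -/
theorem appellSum_zpow_values {y : ℂ} (hy : y ≠ 0) (hy1 : ‖y‖ < 1) (u : ℤ → ℂ)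
    (hu : u = fun m => appellSum (y ^ 5) (y ^ m)) :
    u 3 = u 2 ∧ u 4 = u 1 ∧ u (-1) = -y * u 1 ∧ u (-2) = -y ^ 2 * u 2 ∧
      u (-4) = -y ^ 4 * u 1 ∧ u 6 = -y * u 1 := by
  subst hu
  have n1 := appellSum_zpow_neg_index hy 1
  have n2 := appellSum_zpow_neg_index hy 2
  have n4 := appellSum_zpow_neg_index hy 4
  have p1 := appellSum_zpow_add_five hy hy1 (j := 1) (by decide)
  have p2 := appellSum_zpow_add_five hy hy1 (j := -2) (by decide)
  have p3 := appellSum_zpow_add_five hy hy1 (j := -1) (by decide)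
  norm_num [zpow_neg] at n1 n2 n4 p1 p2 p3
  have e4 : appellSum (y ^ 5) (y ^ (4 : ℤ)) = appellSum (y ^ 5) (y ^ (1 : ℤ)) := by
    rw [zpow_one, show (4 : ℤ) = ((4 : ℕ) : ℤ) from rfl, zpow_natCast, p3, n1]
    field_simp
  refine ⟨?_, e4, ?_, ?_, ?_, ?_⟩
  · change appellSum (y ^ 5) (y ^ (3 : ℕ)) = appellSum (y ^ 5) (y ^ (2 : ℕ))
    rw [p2, n2]
    field_simp
  · simpa [zpow_neg] using n1
  · simpa [zpow_neg] using n2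
  · change appellSum (y ^ 5) (y ^ (-4 : ℤ)) = -y ^ 4 * appellSum (y ^ 5) (y ^ (1 : ℤ))
    rw [← e4]
    simpa [zpow_neg] using n4
  · simpa [zpow_neg] using p1

theorem qRecipSum_zpow_relations {y : ℂ} (hy : y ≠ 0) (hy1 : ‖y‖ < 1) (u e : ℤ → ℂ)
    (hu : u = fun m => appellSum (y ^ 5) (y ^ m)) (he : e = fun m => qRecipSum (y ^ 5) (y ^ m))
    (h1 : u 1 ≠ 0) (h2 : u 2 ≠ 0) :
    3 * e 1 + e 2 + 1 = u 1 ^ 3 / u 2 ^ 2 ∧ 3 * e 2 - e 1 = -y * u 2 ^ 3 / u 1 ^ 2 ∧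
      e 4 = -e 1 := by
  obtain ⟨u3, u4, um1, um2, um4, u6⟩ := appellSum_zpow_values hy hy1 u hu
  have en : ∀ j : ℤ, ¬ (5 : ℤ) ∣ j → e (-j) = -e j - 1 := fun j hj => by
    rw [he]; exact qRecipSum_zpow_neg_index hy hy1 hj
  have e5 : ∀ j k : ℤ, j + 5 = k → e k = e j + 1 := fun j k hk => by
    rw [he, ← hk]; exact qRecipSum_zpow_add_five hy hy1 j
  have e1 := en 1 (by decide)
  have e2 := en 2 (by decide)
  have e3 : e 2 = e (-3) + 1 := e5 (-3) _ rfl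
  have e6 : e (-1) = e (-6) + 1 := e5 (-6) _ rfl
  have e4 : e 4 = e (-1) + 1 := e5 (-1) _ rfl
  have r1 : (e 1 - e (-1) - e (-1) + e (-3)) * (u 2 * u 1 / u 3) =
      u 1 * u 1 / u 2 * (u 1 * u 1 / u 2) := by
    subst he
    exact qRecipSum_zpow_mul_appellSum hy hy1 (i := 2) (j := 1) (k := 1) (by decide) (by decide)
      (by decide) (by decide) (by decide) (by decide) (by decide) (by decide) u hu
      (by change u 3 ≠ 0; rwa [u3]) h2 h2
  have r2 : (e 2 - e (-2) - e (-2) + e (-6)) * (u 4 * u 2 / u 6) =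
      u 2 * u 2 / u 4 * (u 2 * u 2 / u 4) := by
    subst he
    exact qRecipSum_zpow_mul_appellSum hy hy1 (i := 4) (j := 2) (k := 2) (by decide) (by decide)
      (by decide) (by decide) (by decide) (by decide) (by decide) (by decide) u hu
      (by change u 6 ≠ 0; rw [u6]; exact mul_ne_zero (neg_ne_zero.2 hy) h1)
      (by change u 4 ≠ 0; rwa [u4]) (by change u 4 ≠ 0; rwa [u4])
  rw [u3] at r1
  rw [u4, u6] at r2
  refine ⟨?_, ?_, by rw [e4, e1]; ring⟩
  · have : 3 * e 1 + e 2 + 1 = e 1 - e (-1) - e (-1) + e (-3) := by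
      rw [e1, e3]; ring
    rw [this]
    field_simp at r1 ⊢
    linear_combination r1
  · have : 3 * e 2 - e 1 = e 2 - e (-2) - e (-2) + e (-6) := by
      linear_combination 2 * e2 + e6 - e1
    rw [this]
    field_simp at r2 ⊢
    linear_combination -r2

theorem thetaTerm_small_values {q : ℂ} :
    thetaTerm q (-2) = q ∧ thetaTerm q (-1) = -1 ∧ thetaTerm q 0 = 1 ∧ thetaTerm q 1 = -q ∧
      thetaTerm q 2 = q ^ 3 ∧ thetaTerm q 3 = -q ^ 6 ∧ thetaTerm q 4 = q ^ 10 := by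
  refine ⟨?_, ?_, ?_, ?_, ?_, ?_, ?_⟩ <;> norm_num [thetaTerm]

theorem cubeTheta_dissection {q y : ℂ} (hq : q ≠ 0) (hy1 : ‖y‖ < 1) (hqy : q ^ 5 = y)
    (u : ℤ → ℂ) (hu : u = fun m => appellSum (y ^ 5) (y ^ m)) (h1 : u 1 ≠ 0) (h2 : u 2 ≠ 0) :
    cubeTheta q 1 = cubeTheta (y ^ 5) 1 * (u 1 / u 2 - q - q ^ 2 * (u 2 / u 1)) := by
  have hy : y ≠ 0 := hqy ▸ pow_ne_zero 5 hq
  have hq1 : ‖q‖ < 1 := by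
    rw [← hqy, norm_pow] at hy1
    exact (pow_lt_one_iff_of_nonneg (norm_nonneg _) (by norm_num)).1 hy1
  have hQ : y ^ 5 ≠ 0 := pow_ne_zero _ hy
  have hQ1 : ‖y ^ 5‖ < 1 := by
    rw [norm_pow]; exact pow_lt_one₀ (norm_nonneg _) hy1 (by norm_num)
  obtain ⟨u3, u4, um1, um2, um4, u6⟩ := appellSum_zpow_values hy hy1 u hu
  obtain ⟨w2, w1, w0, v1, v2, -, -⟩ := thetaTerm_small_values (q := q)
  set θ : ℤ → ℂ := fun m => cubeTheta (y ^ 5) (y ^ m) with hθ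
  have hd : cubeTheta q 1 = thetaTerm q (-2) ^ 3 * q⁻¹ ^ (-2 : ℤ) * θ (-8) +
      thetaTerm q (-1) ^ 3 * q⁻¹ ^ (-1 : ℤ) * θ (-5) + thetaTerm q 0 ^ 3 * q⁻¹ ^ (0 : ℤ) * θ (-2) +
      thetaTerm q 1 ^ 3 * q⁻¹ ^ (1 : ℤ) * θ 1 + thetaTerm q 2 ^ 3 * q⁻¹ ^ (2 : ℤ) * θ 4 := by
    rw [hθ, ← hqy]
    exact cubeTheta_one_eq_sum_five hq hq1 (-2)
  have refl : ∀ j : ℤ, θ (-5 - j) = θ j := fun j => by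
    simp only [hθ]
    rw [zpow_sub₀ hy, div_eq_mul_inv, zpow_neg]
    exact cubeTheta_inv hQ
  have t8 : θ (-8) = θ 3 := refl 3
  have t5 : θ (-5) = θ 0 := refl 0
  have t2 : θ (-2) = θ (-3) := (refl (-2)).symm
  have t1 : θ 1 = θ (-6) := (refl 1).symm
  have t4 : θ 4 = θ (-9) := (refl 4).symm
  have t9 : θ (-9) = -y * θ 6 := by
    simp only [hθ]
    rw [cubeTheta_mul_pow_three hQ (zpow_ne_zero _ hy),
      show y ^ (-9 : ℤ) * (y ^ 5) ^ 3 = y ^ (6 : ℤ) by rw [zpow_neg]; norm_cast; field_simp]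
    congr 1
    rw [zpow_neg]
    norm_cast
    field_simp
  have q1 : u 2 * (y * θ 3 + θ (-3)) = u 1 * θ 0 := by
    have := appellSum_sq_mul_cubeTheta hQ hQ1 hy
      (by simpa using qGeneric_zpow hy hy1 (j := 1) (by decide))
      (qGeneric_zpow hy hy1 (j := 2) (by decide)) (by simpa [hu] using h1)
    simpa [hu, hθ, zpow_neg] using this
  have q2 : u 4 * (y ^ 2 * θ 6 + θ (-6)) = u 2 * θ 0 := by
    have := appellSum_sq_mul_cubeTheta hQ hQ1 (pow_ne_zero 2 hy)
      (qGeneric_zpow hy hy1 (j := 2) (by decide))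
      (by simpa [← pow_mul] using qGeneric_zpow hy hy1 (j := 4) (by decide))
      (by rw [hu] at h2; exact h2)
    rw [← pow_mul, ← pow_mul] at this
    norm_num at this
    simpa [hu, hθ, zpow_neg] using this
  have hJ : cubeTheta (y ^ 5) 1 = θ 0 := by simp [hθ]
  rw [hJ, hd, w2, w1, w0, v1, v2, t8, t5, t2, t1, t4, t9]
  rw [u4] at q2
  have q1' : θ (-3) = u 1 * θ 0 / u 2 - y * θ 3 := by field_simp; linear_combination q1
  have q2' : θ (-6) = u 2 * θ 0 / u 1 - y ^ 2 * θ 6 := by field_simp; linear_combination q2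
  rw [q1', q2', ← hqy]
  norm_num [zpow_neg]
  norm_cast
  field_simp
  ring

theorem rankAppell_three_eq {q y : ℂ} (hq : q ≠ 0) (hy1 : ‖y‖ < 1) (hqy : q ^ 5 = y)
    (u e : ℤ → ℂ) (hu : u = fun m => appellSum (y ^ 5) (y ^ m))
    (he : e = fun m => qRecipSum (y ^ 5) (y ^ m)) (h1 : u 1 ≠ 0) (h2 : u 2 ≠ 0) :
    rankAppell q (q ^ 3) = -(e 1 + e 2) + q ^ 2 * u 1 + y * cubeAppell (y ^ 5) y 1 *
      (u 1 / u 2 - q - q ^ 2 * (u 2 / u 1)) := by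
  have hy : y ≠ 0 := hqy ▸ pow_ne_zero 5 hq
  have hq1 : ‖q‖ < 1 := by
    rw [← hqy, norm_pow] at hy1
    exact (pow_lt_one_iff_of_nonneg (norm_nonneg _) (by norm_num)).1 hy1
  obtain ⟨u3, u4, um1, um2, um4, u6⟩ := appellSum_zpow_values hy hy1 u hu
  obtain ⟨-, w1, w0, v1, v2, v3, -⟩ := thetaTerm_small_values (q := q)
  set l : ℤ → ℤ → ℂ := fun m n => cubeAppell (y ^ 5) (y ^ m) (y ^ n) with hl
  have hd : rankAppell q (q ^ 3) = thetaTerm q (-1) ^ 3 * (q ^ 3) ^ (-1 : ℤ) * l (-1) (-6) +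
      thetaTerm q 0 ^ 3 * (q ^ 3) ^ (0 : ℤ) * l 0 (-3) +
      thetaTerm q 1 ^ 3 * (q ^ 3) ^ (1 : ℤ) * l 1 0 +
      thetaTerm q 2 ^ 3 * (q ^ 3) ^ (2 : ℤ) * l 2 3 +
      thetaTerm q 3 ^ 3 * (q ^ 3) ^ (3 : ℤ) * l 3 6 := by
    rw [hl, ← hqy]
    exact rankAppell_eq_sum_five hq hq1 3 (-1)
  have a1 : u 1 * u 2 * (l 0 (-3) + e 1 + e 2) + u (-1) * u 1 * l 1 0 +
      u (-2) * u (-1) * l 2 3 = 0 := by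
    subst hu he
    exact appellSum_zpow_mul_cubeAppell_one hy hy1 (i := 1) (j := 2) (by decide) (by decide)
      (by decide)
  have a2 : u 3 * u 1 * u (-1) = u (-2) * u (-4) * l 3 6 + u 2 * u (-2) * l 1 0 +
      u 4 * u 2 * l (-1) (-6) := by
    subst hu
    exact appellSum_zpow_mul_three hy hy1 (i := 3) (j := 1) (k := -1) (by decide) (by decide)
      (by decide) (by decide) (by decide) (by decide)
  have hX : cubeAppell (y ^ 5) y 1 = l 1 0 := by simp [hl]
  rw [u3, um1, um2, um4, u4] at a2
  rw [um1, um2] at a1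
  have a1' : l 0 (-3) = -e 1 - e 2 + y * u 1 * l 1 0 / u 2 - y ^ 3 * l 2 3 := by
    field_simp; apply mul_left_cancel₀ h1; linear_combination a1
  have a2' : l (-1) (-6) = -y * u 1 - y ^ 6 * l 3 6 + y ^ 2 * u 2 * l 1 0 / u 1 := by
    field_simp; apply mul_left_cancel₀ h2; linear_combination -a2
  rw [hX, hd, w1, w0, v1, v2, v3, a1', a2', ← hqy]
  norm_num [zpow_neg]
  norm_cast
  field_simp
  ring

theorem rankAppell_one_eq {q y : ℂ} (hq : q ≠ 0) (hy1 : ‖y‖ < 1) (hqy : q ^ 5 = y)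
    (u e : ℤ → ℂ) (hu : u = fun m => appellSum (y ^ 5) (y ^ m))
    (he : e = fun m => qRecipSum (y ^ 5) (y ^ m)) (h1 : u 1 ≠ 0) (h2 : u 2 ≠ 0) :
    rankAppell q 1 = e 1 - e 2 - q ^ 3 * u 2 - q ^ 3 * y * cubeAppell (y ^ 5) (y ^ 2) 1 *
      (u 1 / u 2 - q - q ^ 2 * (u 2 / u 1)) := by
  have hy : y ≠ 0 := hqy ▸ pow_ne_zero 5 hq
  have hq1 : ‖q‖ < 1 := by
    rw [← hqy, norm_pow] at hy1
    exact (pow_lt_one_iff_of_nonneg (norm_nonneg _) (by norm_num)).1 hy1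
  obtain ⟨u3, u4, um1, um2, um4, u6⟩ := appellSum_zpow_values hy hy1 u hu
  obtain ⟨-, -, w0, v1, v2, v3, v4⟩ := thetaTerm_small_values (q := q)
  set l : ℤ → ℤ → ℂ := fun m n => cubeAppell (y ^ 5) (y ^ m) (y ^ n) with hl
  have hd : rankAppell q (q ^ 0) = thetaTerm q 0 ^ 3 * (q ^ 0) ^ (0 : ℤ) * l 0 (-6) +
      thetaTerm q 1 ^ 3 * (q ^ 0) ^ (1 : ℤ) * l 1 (-3) +
      thetaTerm q 2 ^ 3 * (q ^ 0) ^ (2 : ℤ) * l 2 0 +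
      thetaTerm q 3 ^ 3 * (q ^ 0) ^ (3 : ℤ) * l 3 3 +
      thetaTerm q 4 ^ 3 * (q ^ 0) ^ (4 : ℤ) * l 4 6 := by
    rw [hl, ← hqy]
    exact rankAppell_eq_sum_five hq hq1 0 0
  have a1 : u 2 * u 4 * (l 0 (-6) + e 2 + e 4) + u (-2) * u 2 * l 2 0 +
      u (-4) * u (-2) * l 4 6 = 0 := by
    subst hu he
    exact appellSum_zpow_mul_cubeAppell_one hy hy1 (i := 2) (j := 4) (by decide) (by decide)
      (by decide)
  have a2 : u 3 * u 2 * u 1 = u (-1) * u (-2) * l 3 3 + u 1 * u (-1) * l 2 0 +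
      u 2 * u 1 * l 1 (-3) := by
    subst hu
    exact appellSum_zpow_mul_three hy hy1 (i := 3) (j := 2) (k := 1) (by decide) (by decide)
      (by decide) (by decide) (by decide) (by decide)
  have e4 := (qRecipSum_zpow_relations hy hy1 u e hu he h1 h2).2.2
  have hY : cubeAppell (y ^ 5) (y ^ 2) 1 = l 2 0 := by simp [hl]
  rw [u3, um1, um2] at a2
  rw [um2, um4, u4, e4] at a1
  have a1' : l 0 (-6) = e 1 - e 2 + y ^ 2 * u 2 * l 2 0 / u 1 - y ^ 6 * l 4 6 := by
    field_simp; apply mul_left_cancel₀ h2; linear_combination a1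
  have a2' : l 1 (-3) = u 2 - y ^ 3 * l 3 3 + y * u 1 * l 2 0 / u 2 := by
    field_simp; apply mul_left_cancel₀ h1; linear_combination -a2
  rw [pow_zero] at hd
  rw [hY, hd, w0, v1, v2, v3, v4, a1', a2', ← hqy]
  norm_num [zpow_neg]
  field_simp
  ring

/-- The rank series are, up to the factor `cubeTheta q 1`, polynomials of degree at most three in
`q` whose coefficients only depend on `q ^ 5`. -/
theorem exists_rankAppell_eq_cubeTheta_mul {y : ℂ} (hy : y ≠ 0) (hy1 : ‖y‖ ≤ 1 / 8)
    (hJ : cubeTheta (y ^ 5) 1 ≠ 0) :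
    ∃ a b : Fin 4 → ℂ, ∀ q, q ^ 5 = y →
      2 * rankAppell q 1 + rankAppell q (q ^ 3) = cubeTheta q 1 * ∑ i, a i * q ^ (i : ℕ) ∧
      1 - 3 * rankAppell q (q ^ 3) - rankAppell q 1 =
        cubeTheta q 1 * ∑ i, b i * q ^ (i : ℕ) := by
  have hr : 0 < ‖y‖ := norm_pos_iff.2 hy
  have hy1' : ‖y‖ < 1 := by linarith
  obtain ⟨u, hu⟩ : ∃ u : ℤ → ℂ, u = fun m => appellSum (y ^ 5) (y ^ m) := ⟨_, rfl⟩
  obtain ⟨e, he⟩ : ∃ e : ℤ → ℂ, e = fun m => qRecipSum (y ^ 5) (y ^ m) := ⟨_, rfl⟩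
  have nz : ∀ c : ℂ, ‖c - 1‖ < 1 → c ≠ 0 := by
    rintro c hc rfl
    norm_num at hc
  have h1 : u 1 ≠ 0 := nz _ <| by
    simpa [hu] using norm_appellSum_sub_one_lt hy hy1 le_rfl (by nlinarith)
  have h2 : u 2 ≠ 0 := nz _ <| by
    rw [hu]
    refine norm_appellSum_sub_one_lt hy hy1 ?_ (norm_zpow y 2).ge
    rw [norm_zpow]
    norm_cast
    nlinarith
  obtain ⟨r1, r2, -⟩ := qRecipSum_zpow_relations hy hy1' u e hu he h1 h2
  set J := cubeTheta (y ^ 5) 1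
  set X := cubeAppell (y ^ 5) y 1
  set Y := cubeAppell (y ^ 5) (y ^ 2) 1
  refine ⟨![y * X / J, 0, u 2 / J, -(2 * y * Y + u 2 ^ 2 / u 1) / J],
    ![(-3 * y * X + u 1 ^ 2 / u 2) / J, u 1 / J, -u 2 / J, (y * Y + u 2 ^ 2 / u 1) / J],
    fun q hqy => ?_⟩
  have hq : q ≠ 0 := by
    rintro rfl
    exact hy (by rw [← hqy]; norm_num)
  have hφ := cubeTheta_dissection hq hy1' hqy u hu h1 h2
  have s4 := rankAppell_three_eq hq hy1' hqy u e hu he h1 h2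
  have s1 := rankAppell_one_eq hq hy1' hqy u e hu he h1 h2
  have k1 : e 1 - 3 * e 2 = y * u 2 ^ 3 / u 1 ^ 2 := by linear_combination -r2
  have k2 : 1 + 2 * e 1 + 4 * e 2 = u 1 ^ 3 / u 2 ^ 2 - y * u 2 ^ 3 / u 1 ^ 2 := by
    linear_combination r1 + r2
  change cubeTheta q 1 = J * _ at hφ
  rw [s4, s1, hφ, Fin.sum_univ_four, Fin.sum_univ_four]
  constructor
  · calc _ = e 1 - 3 * e 2 - 2 * q ^ 3 * u 2 -
          2 * (q ^ 3 * y * Y * (u 1 / u 2 - q - q ^ 2 * (u 2 / u 1))) + q ^ 2 * u 1 +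
          y * X * (u 1 / u 2 - q - q ^ 2 * (u 2 / u 1)) := by ring
      _ = _ := by
        rw [k1, ← hqy]
        simp
        field_simp
        ring
  · calc _ = 1 + 2 * e 1 + 4 * e 2 -
          3 * (q ^ 2 * u 1 + y * X * (u 1 / u 2 - q - q ^ 2 * (u 2 / u 1))) + q ^ 3 * u 2 +
          q ^ 3 * y * Y * (u 1 / u 2 - q - q ^ 2 * (u 2 / u 1)) := by ring
      _ = _ := by
        rw [k2, ← hqy]
        simp
        field_simp
        ring

theorem YoungDiagram.sum_rowLens (μ : YoungDiagram) : μ.rowLens.sum = μ.card := by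
  have h : Set.MapsTo Prod.fst (μ.cells : Set (ℕ × ℕ)) (Finset.range (μ.colLen 0)) := by
    rintro ⟨i, j⟩ hc
    rw [Finset.coe_range, Set.mem_Iio, ← YoungDiagram.mem_iff_lt_colLen]
    exact μ.up_left_mem le_rfl (Nat.zero_le j) (by simpa using hc)
  rw [YoungDiagram.card, Finset.card_eq_sum_card_fiberwise h, YoungDiagram.rowLens]
  exact congrArg List.sum (List.map_congr_left fun i _ => μ.rowLen_eq_card)

theorem YoungDiagram.sup_rowLens (μ : YoungDiagram) :
    (μ.rowLens : Multiset ℕ).sup = μ.rowLen 0 := by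
  refine le_antisymm (Multiset.sup_le.2 fun b hb => ?_) ?_
  · obtain ⟨i, -, rfl⟩ := List.mem_map.1 (Multiset.mem_coe.1 hb)
    exact μ.rowLen_anti 0 i (Nat.zero_le i)
  · rcases Nat.eq_zero_or_pos (μ.rowLen 0) with h | h
    · rw [h]
      exact Nat.zero_le _
    · refine Multiset.le_sup (Multiset.mem_coe.2 (List.mem_map.2 ⟨0, ?_, rfl⟩))
      rwa [List.mem_range, ← YoungDiagram.mem_iff_lt_colLen, YoungDiagram.mem_iff_lt_rowLen]

theorem YoungDiagram.card_transpose (μ : YoungDiagram) : μ.transpose.card = μ.card :=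
  Finset.card_map _

/-- The Young diagram of a partition. -/
def Nat.Partition.toYoungDiagram {n : ℕ} (P : n.Partition) : YoungDiagram :=
  YoungDiagram.ofRowLens (P.parts.sort (· ≥ ·)) (P.parts.pairwise_sort (· ≥ ·)).sortedGE

theorem Nat.Partition.rowLens_toYoungDiagram {n : ℕ} (P : n.Partition) :
    (P.toYoungDiagram.rowLens : Multiset ℕ) = P.parts := by
  rw [Nat.Partition.toYoungDiagram, YoungDiagram.rowLens_ofRowLens_eq_self, Multiset.sort_eq]
  intro x hx
  exact P.parts_pos ((Multiset.mem_sort _).1 hx)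

theorem Nat.Partition.card_toYoungDiagram {n : ℕ} (P : n.Partition) :
    P.toYoungDiagram.card = n := by
  rw [← YoungDiagram.sum_rowLens, ← Multiset.sum_coe, P.rowLens_toYoungDiagram, P.parts_sum]

theorem Nat.Partition.rank_eq {n : ℕ} (P : n.Partition) :
    partitionRank P = P.toYoungDiagram.rowLen 0 - P.toYoungDiagram.colLen 0 := by
  rw [partitionRank, ← P.rowLens_toYoungDiagram, YoungDiagram.sup_rowLens, Multiset.coe_card,
    YoungDiagram.length_rowLens]

/-- The conjugate partition, obtained by transposing the Young diagram. -/
def Nat.Partition.conjugate {n : ℕ} (P : n.Partition) : n.Partition where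
  parts := P.toYoungDiagram.transpose.rowLens
  parts_pos h := YoungDiagram.pos_of_mem_rowLens _ _ (Multiset.mem_coe.1 h)
  parts_sum := by
    rw [Multiset.sum_coe, YoungDiagram.sum_rowLens, YoungDiagram.card_transpose,
      P.card_toYoungDiagram]

theorem Nat.Partition.toYoungDiagram_conjugate {n : ℕ} (P : n.Partition) :
    P.conjugate.toYoungDiagram = P.toYoungDiagram.transpose := by
  apply YoungDiagram.equivListRowLens.injective
  apply Subtype.ext
  have h := P.conjugate.rowLens_toYoungDiagram
  exact (Multiset.coe_eq_coe.1 h).eq_of_pairwise' (r := (· ≥ ·))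
    (YoungDiagram.rowLens_sorted _).pairwise (YoungDiagram.rowLens_sorted _).pairwise

theorem Nat.Partition.conjugate_conjugate {n : ℕ} (P : n.Partition) :
    P.conjugate.conjugate = P := by
  apply Nat.Partition.ext
  rw [← P.conjugate.conjugate.rowLens_toYoungDiagram, ← P.rowLens_toYoungDiagram,
    toYoungDiagram_conjugate, toYoungDiagram_conjugate, YoungDiagram.transpose_transpose]

theorem Nat.Partition.rank_conjugate {n : ℕ} (P : n.Partition) :
    partitionRank P.conjugate = -partitionRank P := by
  rw [rank_eq, rank_eq, toYoungDiagram_conjugate, YoungDiagram.rowLen_transpose,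
    YoungDiagram.colLen_transpose, neg_sub]

/-- Conjugation as a permutation of the partitions of `n`. -/
def Nat.Partition.conjugateEquiv (n : ℕ) : n.Partition ≃ n.Partition :=
  Function.Involutive.toPerm _ Nat.Partition.conjugate_conjugate

/-- Removes one from every part, dropping the parts that become zero. -/
def removeColumn (m : Multiset ℕ) : Multiset ℕ := (m.map Nat.pred).filter (0 < ·)

/-- Adds one to every part of a multiset viewed as having `L` parts, some of them zero. -/
def addColumn (L : ℕ) (m : Multiset ℕ) : Multiset ℕ :=
  m.map Nat.succ + Multiset.replicate (L - m.card) 1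

theorem removeColumn_addColumn (L : ℕ) {m : Multiset ℕ} (hm : ∀ i ∈ m, 0 < i) :
    removeColumn (addColumn L m) = m := by
  rw [removeColumn, addColumn, Multiset.map_add, Multiset.filter_add, Multiset.map_map,
    Multiset.map_replicate]
  have h1 : Multiset.filter (0 < ·) (Multiset.replicate (L - m.card) (Nat.pred 1)) = 0 :=
    Multiset.filter_eq_nil.2 fun a ha => by
      rw [Multiset.eq_of_mem_replicate ha]
      simp
  have h2 : Nat.pred ∘ Nat.succ = id := rfl
  rw [h1, h2, Multiset.map_id, add_zero, Multiset.filter_eq_self.2 hm]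

theorem card_removeColumn_le (m : Multiset ℕ) : (removeColumn m).card ≤ m.card := by
  rw [removeColumn, ← Multiset.card_map Nat.pred m]
  exact Multiset.card_le_card (Multiset.filter_le _ _)

theorem addColumn_removeColumn {m : Multiset ℕ} (hm : ∀ i ∈ m, 0 < i) :
    addColumn m.card (removeColumn m) = m := by
  induction m using Multiset.induction with
  | empty => rfl
  | cons a m ih =>
    have ih := ih fun i hi => hm i (Multiset.mem_cons_of_mem hi)
    have ha := hm a (Multiset.mem_cons_self a m)
    have hc := card_removeColumn_le m
    rw [addColumn] at ih ⊢
    by_cases h : 0 < a.pred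
    · have e : removeColumn (a ::ₘ m) = a.pred ::ₘ removeColumn m := by
        rw [removeColumn, Multiset.map_cons, Multiset.filter_cons_of_pos _ h]
        rfl
      rw [e, Multiset.map_cons, Multiset.card_cons, Multiset.card_cons, Nat.add_sub_add_right,
        Multiset.cons_add, ih, Nat.succ_pred_eq_of_pos ha]
    · have e : removeColumn (a ::ₘ m) = removeColumn m := by
        simp only [removeColumn, Multiset.map_cons]
        rw [Multiset.filter_cons_of_neg _ h]
      have a1 : a = 1 := by
        rw [Nat.pred_eq_sub_one] at h
        omega
      rw [e, Multiset.card_cons, Nat.succ_sub hc, Multiset.replicate_succ, Multiset.add_cons, ih, a1]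

theorem sum_removeColumn {m : Multiset ℕ} (hm : ∀ i ∈ m, 0 < i) :
    (removeColumn m).sum + m.card = m.sum := by
  induction m using Multiset.induction with
  | empty => rfl
  | cons a m ih =>
    have ih := ih fun i hi => hm i (Multiset.mem_cons_of_mem hi)
    have ha := hm a (Multiset.mem_cons_self a m)
    by_cases h : 0 < a.pred
    · have e : removeColumn (a ::ₘ m) = a.pred ::ₘ removeColumn m := by
        rw [removeColumn, Multiset.map_cons, Multiset.filter_cons_of_pos _ h]
        rfl
      rw [e, Multiset.sum_cons, Multiset.sum_cons, Multiset.card_cons, Nat.pred_eq_sub_one]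
      omega
    · have e : removeColumn (a ::ₘ m) = removeColumn m := by
        simp only [removeColumn, Multiset.map_cons]
        rw [Multiset.filter_cons_of_neg _ h]
      rw [Nat.pred_eq_sub_one] at h
      rw [e, Multiset.sum_cons, Multiset.card_cons]
      omega

theorem sum_addColumn {L : ℕ} {m : Multiset ℕ} (h : m.card ≤ L) :
    (addColumn L m).sum = m.sum + L := by
  have : (m.map Nat.succ).sum = m.sum + m.card := by
    simp
  rw [addColumn, Multiset.sum_add, this, Multiset.sum_replicate, smul_eq_mul, mul_one]
  omega

theorem card_addColumn {L : ℕ} {m : Multiset ℕ} (h : m.card ≤ L) : (addColumn L m).card = L := by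
  rw [addColumn, Multiset.card_add, Multiset.card_map, Multiset.card_replicate]
  omega

theorem pos_of_mem_addColumn {L : ℕ} {m : Multiset ℕ} {i : ℕ} (h : i ∈ addColumn L m) : 0 < i := by
  rcases Multiset.mem_add.1 h with h | h
  · obtain ⟨j, -, rfl⟩ := Multiset.mem_map.1 h
    exact Nat.succ_pos j
  · rw [Multiset.eq_of_mem_replicate h]
    exact one_pos

theorem Multiset.sup_mem_of_ne_zero {m : Multiset ℕ} (h : m ≠ 0) : m.sup ∈ m := by
  induction m using Multiset.induction with
  | empty => exact absurd rfl h
  | cons a m ih =>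
    rw [Multiset.sup_cons]
    rcases le_total a m.sup with h1 | h1
    · rw [sup_eq_right.2 h1]
      by_cases hm : m = 0
      · subst hm
        simp at h1 ⊢
        exact h1.symm
      · exact Multiset.mem_cons_of_mem (ih hm)
    · rw [sup_eq_left.2 h1]
      exact Multiset.mem_cons_self a m

theorem Nat.Partition.card_erase_sup {n s : ℕ} {P : (n + s + 1).Partition}
    (h : (s : ℤ) ≤ partitionRank P) :
    P.parts.sup ∈ P.parts ∧
      (P.parts.erase P.parts.sup).card ≤ P.parts.sup - (s + 1) ∧ s + 1 ≤ P.parts.sup ∧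
      (P.parts.erase P.parts.sup).sum + P.parts.sup = n + s + 1 := by
  have h0 : P.parts ≠ 0 := fun h0 => by
    have := P.parts_sum
    rw [h0, Multiset.sum_zero] at this
    omega
  have hM := Multiset.sup_mem_of_ne_zero h0
  have hc := Multiset.card_erase_add_one hM
  have hs := Multiset.sum_erase hM
  rw [P.parts_sum] at hs
  rw [partitionRank] at h
  refine ⟨hM, ?_, ?_, ?_⟩ <;> omega

/-- Dyson's adjoint correspondence: a partition with `l` parts is sent to the one obtained by
removing a column and inserting a new part `l + s + 1`. -/
noncomputable def dysonAdjoint (n s : ℕ) : {P : n.Partition // partitionRank P ≤ s + 2} ≃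
    {P : (n + s + 1).Partition // (s : ℤ) ≤ partitionRank P} where
  toFun P := ⟨⟨(P.1.parts.card + s + 1) ::ₘ removeColumn P.1.parts, fun {i} hi => by
      rcases Multiset.mem_cons.1 hi with rfl | hi
      · omega
      · exact (Multiset.mem_filter.1 hi).2, by
      rw [Multiset.sum_cons]
      have := sum_removeColumn (fun i hi => P.1.parts_pos hi)
      rw [P.1.parts_sum] at this
      omega⟩, by
    rw [partitionRank, Multiset.card_cons, Multiset.sup_cons]
    have h1 := card_removeColumn_le P.1.parts
    have h2 : P.1.parts.card + s + 1 ≤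
        (P.1.parts.card + s + 1) ⊔ (removeColumn P.1.parts).sup := le_sup_left
    omega⟩
  invFun P := ⟨⟨addColumn (P.1.parts.sup - (s + 1)) (P.1.parts.erase P.1.parts.sup),
      pos_of_mem_addColumn, by
      obtain ⟨-, h1, h2, h3⟩ := Nat.Partition.card_erase_sup P.2
      rw [sum_addColumn h1]
      omega⟩, by
    obtain ⟨hM, h1, h2, h3⟩ := Nat.Partition.card_erase_sup P.2
    have : (addColumn (P.1.parts.sup - (s + 1)) (P.1.parts.erase P.1.parts.sup)).sup
        ≤ P.1.parts.sup + 1 := by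
      refine Multiset.sup_le.2 fun i hi => ?_
      rcases Multiset.mem_add.1 hi with hi | hi
      · obtain ⟨j, hj, rfl⟩ := Multiset.mem_map.1 hi
        exact Nat.succ_le_succ (Multiset.le_sup (Multiset.mem_of_mem_erase hj))
      · rw [Multiset.eq_of_mem_replicate hi]
        omega
    change ((addColumn _ _).sup : ℤ) - (addColumn _ _).card ≤ _
    rw [card_addColumn h1]
    omega⟩
  left_inv P := by
    apply Subtype.ext
    apply Nat.Partition.ext
    have h : ((P.1.parts.card + s + 1) ::ₘ removeColumn P.1.parts).sup
        = P.1.parts.card + s + 1 := by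
      rw [Multiset.sup_cons, sup_eq_left]
      refine Multiset.sup_le.2 fun i hi => ?_
      obtain ⟨j, hj, rfl⟩ := Multiset.mem_map.1 (Multiset.mem_filter.1 hi).1
      have h1 := Multiset.le_sup hj
      have h2 := P.2
      rw [partitionRank] at h2
      rw [Nat.pred_eq_sub_one]
      omega
    dsimp only
    rw [h, Multiset.erase_cons_head, Nat.add_assoc, Nat.add_sub_cancel]
    exact addColumn_removeColumn fun i hi => P.1.parts_pos hi
  right_inv P := by
    apply Subtype.ext
    apply Nat.Partition.ext
    obtain ⟨hM, h1, h2, h3⟩ := Nat.Partition.card_erase_sup P.2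
    dsimp only
    rw [card_addColumn h1, removeColumn_addColumn, Nat.add_assoc, Nat.sub_add_cancel h2,
      Multiset.cons_erase hM]
    exact fun i hi => P.1.parts_pos (Multiset.mem_of_mem_erase hi)

/-- The number of partitions of `n` whose rank is at least `s`. -/
def rankTail (n s : ℕ) : ℕ := Fintype.card {P : n.Partition // (s : ℤ) ≤ partitionRank P}

theorem rankTail_add_rankTail (n s : ℕ) :
    rankTail (n + s + 1) s + rankTail n (s + 3) = partitionFn n := by
  rw [rankTail, ← Fintype.card_congr (dysonAdjoint n s), rankTail, partitionFn,
    ← Fintype.card_congr (Equiv.sumCompl fun P : n.Partition => partitionRank P ≤ s + 2),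
    Fintype.card_sum]
  refine congrArg _ (Fintype.card_congr (Equiv.subtypeEquivRight fun P => ?_))
  push_cast
  omega

theorem rankTail_le (n s : ℕ) : rankTail n s ≤ partitionFn n :=
  Fintype.card_subtype_le _

theorem partitionRank_le {n : ℕ} (P : n.Partition) : partitionRank P ≤ n := by
  have h : P.parts.sup ≤ n := Multiset.sup_le.2 fun i hi => P.le_of_mem_parts hi
  rw [partitionRank]
  omega

theorem partitionRank_lt {n : ℕ} (hn : n ≠ 0) (P : n.Partition) : partitionRank P < n := by
  have h : P.parts.sup ≤ n := Multiset.sup_le.2 fun i hi => P.le_of_mem_parts hi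
  have h0 : P.parts.card ≠ 0 := fun h0 => by
    have h1 := P.parts_sum
    rw [Multiset.card_eq_zero.1 h0, Multiset.sum_zero] at h1
    exact hn h1.symm
  rw [partitionRank]
  omega

theorem rankTail_eq_zero {n s : ℕ} (hns : n ≤ s) (hs : s ≠ 0) : rankTail n s = 0 := by
  rw [rankTail, Fintype.card_eq_zero_iff]
  refine ⟨fun P => ?_⟩
  have h := P.2
  rcases eq_or_ne n 0 with hn | hn
  · have := partitionRank_le P.1
    omega
  · have := partitionRank_lt hn P.1
    omega

theorem rankTail_zero_zero : rankTail 0 0 = 1 := by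
  rw [rankTail]
  decide

theorem partitionFn_le_two_pow (n : ℕ) : partitionFn n ≤ 2 ^ n := by
  have h := Fintype.card_le_of_surjective _ (@Nat.Partition.ofComposition_surj n)
  rw [composition_card] at h
  exact h.trans (Nat.pow_le_pow_right two_pos (Nat.sub_le _ _))

theorem sum_partitionRank_neg {M : Type*} [AddCommMonoid M] (n : ℕ) (f : ℤ → M) :
    ∑ P : n.Partition, f (-partitionRank P) = ∑ P : n.Partition, f (partitionRank P) := by
  rw [← Equiv.sum_comp (Nat.Partition.conjugateEquiv n) fun P => f (partitionRank P)]
  exact Finset.sum_congr rfl fun P _ => congrArg f P.rank_conjugate.symm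

theorem rankTail_eq_sum (n s : ℕ) :
    (rankTail n s : ℤ) = ∑ P : n.Partition, if (s : ℤ) ≤ partitionRank P then 1 else 0 := by
  rw [rankTail, Fintype.card_subtype, Finset.card_filter]
  push_cast
  rfl

theorem rankCount_eq_sum (a b : ℤ) (n : ℕ) :
    (rankCount a b n : ℤ) = ∑ P : n.Partition, if partitionRank P % b = a % b then 1 else 0 := by
  rw [rankCount, Fintype.card_subtype, Finset.card_filter]
  push_cast
  rfl

theorem partitionFn_eq_sum (n : ℕ) : (partitionFn n : ℤ) = ∑ _P : n.Partition, 1 := by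
  rw [partitionFn, Finset.sum_const, Finset.card_univ, nsmul_one]

theorem partitionFn_eq_rankTail_add (n : ℕ) : partitionFn n = rankTail n 0 + rankTail n 1 := by
  zify
  rw [partitionFn_eq_sum, rankTail_eq_sum, rankTail_eq_sum,
    ← sum_partitionRank_neg n fun r => if ((1 : ℕ) : ℤ) ≤ r then (1 : ℤ) else 0,
    ← Finset.sum_add_distrib]
  refine Finset.sum_congr rfl fun P _ => ?_
  split_ifs <;> omega

theorem sum_ite_le_sub_ite_le (N c : ℕ) (hc : 0 < c) (hc5 : c < 5) (r : ℤ) (hr : r ≤ N) :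
    ∑ j ∈ Finset.range N, ((if ((5 * j + c : ℕ) : ℤ) ≤ r then (1 : ℤ) else 0) -
      (if ((5 * j + (c + 1) : ℕ) : ℤ) ≤ r then 1 else 0)) = if 0 < r ∧ r % 5 = c then 1 else 0 := by
  have h : ∀ j ∈ Finset.range N, ((if ((5 * j + c : ℕ) : ℤ) ≤ r then (1 : ℤ) else 0) -
      (if ((5 * j + (c + 1) : ℕ) : ℤ) ≤ r then 1 else 0)) =
      if (r / 5).toNat = j then (if 0 < r ∧ r % 5 = c then 1 else 0) else 0 := by
    intro j _
    split_ifs <;> omega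
  rw [Finset.sum_congr rfl h, Finset.sum_ite_eq]
  split_ifs with h1 h2 h2
  · rfl
  · rfl
  · rw [Finset.mem_range] at h1
    omega
  · rfl

/-- The number of pairs of a partition of `n` and `j` for which the rank is at least `5 * j + b`. -/
def rankTailSum (b n : ℕ) : ℕ := ∑ j ∈ Finset.range n, rankTail n (5 * j + b)

theorem rankTailSum_sub (b n : ℕ) (hb : 0 < b) (hb5 : b < 5) :
    (rankTailSum b n : ℤ) - rankTailSum (b + 1) n =
      ∑ P : n.Partition, if 0 < partitionRank P ∧ partitionRank P % 5 = b then 1 else 0 := by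
  rw [rankTailSum, rankTailSum]
  push_cast
  simp only [rankTail_eq_sum]
  rw [← Finset.sum_sub_distrib]
  simp only [← Finset.sum_sub_distrib]
  rw [Finset.sum_comm]
  exact Finset.sum_congr rfl fun P _ =>
    sum_ite_le_sub_ite_le n b hb hb5 _ (partitionRank_le P)

theorem rankCount_one_five (n : ℕ) : (rankCount 1 5 n : ℤ) =
    rankTailSum 1 n - rankTailSum 2 n + (rankTailSum 4 n - rankTailSum 5 n) := by
  rw [rankTailSum_sub 1 n one_pos (by norm_num), rankTailSum_sub 4 n four_pos (by norm_num),
    rankCount_eq_sum,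
    ← sum_partitionRank_neg n fun r => if 0 < r ∧ r % 5 = ((4 : ℕ) : ℤ) then (1 : ℤ) else 0,
    ← Finset.sum_add_distrib]
  refine Finset.sum_congr rfl fun P _ => ?_
  split_ifs <;> omega

theorem rankCount_two_five (n : ℕ) : (rankCount 2 5 n : ℤ) =
    rankTailSum 2 n - rankTailSum 4 n := by
  have h : (rankTailSum 2 n : ℤ) - rankTailSum 4 n =
      (rankTailSum 2 n - rankTailSum 3 n) + (rankTailSum 3 n - rankTailSum 4 n) := by ring
  rw [h, rankTailSum_sub 2 n two_pos (by norm_num), rankTailSum_sub 3 n three_pos (by norm_num),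
    rankCount_eq_sum,
    ← sum_partitionRank_neg n fun r => if 0 < r ∧ r % 5 = ((3 : ℕ) : ℤ) then (1 : ℤ) else 0,
    ← Finset.sum_add_distrib]
  refine Finset.sum_congr rfl fun P _ => ?_
  split_ifs <;> omega

theorem rankCount_neg_eq_sum (a b : ℤ) (n : ℕ) : (rankCount a b n : ℤ) =
    ∑ P : n.Partition, if -partitionRank P % b = a % b then 1 else 0 :=
  (rankCount_eq_sum a b n).trans
    (sum_partitionRank_neg n fun r => if r % b = a % b then (1 : ℤ) else 0).symm

theorem partitionFn_eq_rankCount_add (n : ℕ) :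
    (partitionFn n : ℤ) = rankCount 0 5 n + 2 * rankCount 1 5 n + 2 * rankCount 2 5 n := by
  have h1 : (2 * rankCount 1 5 n : ℤ) = rankCount 1 5 n + rankCount 1 5 n := two_mul _
  have h2 : (2 * rankCount 2 5 n : ℤ) = rankCount 2 5 n + rankCount 2 5 n := two_mul _
  rw [h1, h2]
  conv_rhs =>
    congr
    · congr
      · rw [rankCount_eq_sum]
      · congr
        · rw [rankCount_eq_sum]
        · rw [rankCount_neg_eq_sum]
    · congr
      · rw [rankCount_eq_sum]
      · rw [rankCount_neg_eq_sum]
  simp only [partitionFn_eq_sum, ← Finset.sum_add_distrib]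
  refine Finset.sum_congr rfl fun P _ => ?_
  split_ifs <;> omega

/-- The generating function of the number of partitions. -/
noncomputable def partitionSeries (q : ℂ) : ℂ := ∑' n : ℕ, (partitionFn n : ℂ) * q ^ n

/-- The generating function of the number of partitions of rank at least `s`. -/
noncomputable def rankTailSeries (q : ℂ) (s : ℕ) : ℂ := ∑' n : ℕ, (rankTail n s : ℂ) * q ^ n

/-- The terms of the quotient of `rankTailSeries` by `partitionSeries`. -/
noncomputable def rankTailTerm (q : ℂ) (s : ℕ) (k : ℤ) : ℂ :=
  -(thetaTerm q k ^ 3 * (q ^ ((s : ℤ) - 2)) ^ k)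

theorem norm_mul_pow_le {q : ℂ} (hq1 : ‖q‖ ≤ 1 / 8) {a : ℂ} {n : ℕ} (ha : ‖a‖ ≤ 2 ^ n) :
    ‖a * q ^ n‖ ≤ (1 / 4) ^ n := by
  rw [norm_mul, norm_pow]
  calc ‖a‖ * ‖q‖ ^ n ≤ 2 ^ n * (1 / 8) ^ n := by gcongr
    _ = (1 / 4) ^ n := by rw [← mul_pow]; norm_num

theorem norm_partitionFn_le (n : ℕ) : ‖(partitionFn n : ℂ)‖ ≤ 2 ^ n := by
  rw [Complex.norm_natCast]
  exact_mod_cast partitionFn_le_two_pow n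

theorem norm_rankTail_le (n s : ℕ) : ‖(rankTail n s : ℂ)‖ ≤ 2 ^ n := by
  rw [Complex.norm_natCast]
  exact_mod_cast (rankTail_le n s).trans (partitionFn_le_two_pow n)

theorem summable_mul_pow {q : ℂ} (hq1 : ‖q‖ ≤ 1 / 8) {a : ℕ → ℂ} (ha : ∀ n, ‖a n‖ ≤ 2 ^ n) :
    Summable fun n => a n * q ^ n :=
  Summable.of_norm_bounded (summable_geometric_of_lt_one (by norm_num) (by norm_num))
    fun n => norm_mul_pow_le hq1 (ha n)

theorem norm_rankTailSeries_le {q : ℂ} (hq1 : ‖q‖ ≤ 1 / 8) (s : ℕ) :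
    ‖rankTailSeries q s‖ ≤ (1 - 1 / 4)⁻¹ :=
  tsum_of_norm_bounded (hasSum_geometric_of_lt_one (by norm_num) (by norm_num))
    fun n => norm_mul_pow_le hq1 (norm_rankTail_le n s)

theorem rankTailSeries_eq {q : ℂ} (hq1 : ‖q‖ ≤ 1 / 8) (s : ℕ) : rankTailSeries q s =
    (if s = 0 then 1 else 0) + q ^ (s + 1) * (partitionSeries q - rankTailSeries q (s + 3)) := by
  have hP := summable_mul_pow hq1 norm_partitionFn_le
  have hG := summable_mul_pow hq1 fun n => norm_rankTail_le n (s + 3)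
  rw [rankTailSeries, ← (summable_mul_pow hq1 fun n => norm_rankTail_le n s).sum_add_tsum_nat_add
    (s + 1), partitionSeries, rankTailSeries, ← hP.tsum_sub hG, ← tsum_mul_left]
  refine congrArg₂ _ ?_ (tsum_congr fun n => ?_)
  · rcases eq_or_ne s 0 with rfl | hs
    · simp [rankTail_zero_zero]
    · rw [if_neg hs]
      refine Finset.sum_eq_zero fun n hn => ?_
      rw [rankTail_eq_zero (Nat.lt_succ_iff.1 (Finset.mem_range.1 hn)) hs, Nat.cast_zero, zero_mul]
  · rw [← rankTail_add_rankTail n s, ← add_assoc n s 1, Nat.cast_add]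
    ring

theorem summable_rankTailTerm {q : ℂ} (hq : q ≠ 0) (hq1 : ‖q‖ < 1) (s : ℕ) :
    Summable fun n : ℕ => rankTailTerm q s (n + 1) := by
  have h := (summable_thetaTerm_cube_mul_zpow hq hq1 (zpow_ne_zero ((s : ℤ) - 2) hq)).of_norm.neg
  exact h.comp_injective (i := fun n : ℕ => (n : ℤ) + 1) fun a b hab => by simpa using hab

theorem norm_rankTailTerm_le {q : ℂ} (hq : q ≠ 0) (hq1 : ‖q‖ ≤ 1) (s n : ℕ) :
    ‖rankTailTerm q s (n + 1)‖ ≤ ‖q‖ ^ n * ‖q‖ ^ s := by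
  have hq0 : 0 < ‖q‖ := norm_pos_iff.2 hq
  have h := norm_thetaTerm_natCast_le hq hq1 (n + 1)
  push_cast at h
  rw [rankTailTerm, norm_neg, norm_mul, norm_pow, norm_zpow, norm_zpow]
  calc ‖thetaTerm q (n + 1)‖ ^ 3 * (‖q‖ ^ ((s : ℤ) - 2)) ^ ((n : ℤ) + 1)
      ≤ (‖q‖ ^ (n + 1)) ^ 3 * (‖q‖ ^ ((s : ℤ) - 2)) ^ ((n : ℤ) + 1) := by gcongr
    _ = ‖q‖ ^ ((n + 1) + s * (n + 1)) := by
      rw [← zpow_mul, ← pow_mul, ← zpow_natCast, ← zpow_natCast, ← zpow_add₀ hq0.ne']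
      push_cast
      ring_nf
    _ ≤ ‖q‖ ^ (n + s) := pow_le_pow_of_le_one hq0.le hq1 (by nlinarith)
    _ = ‖q‖ ^ n * ‖q‖ ^ s := pow_add _ _ _

theorem rankTailTerm_one {q : ℂ} (hq : q ≠ 0) (s : ℕ) : rankTailTerm q s 1 = q ^ (s + 1) := by
  rw [rankTailTerm, thetaTerm_one, zpow_one, zpow_sub₀ hq, zpow_natCast]
  field_simp
  rw [pow_succ']

theorem rankTailTerm_add_one {q : ℂ} (hq : q ≠ 0) (s : ℕ) (k : ℤ) :
    rankTailTerm q s (k + 1) = -(q ^ (s + 1) * rankTailTerm q (s + 3) k) := by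
  rw [rankTailTerm, rankTailTerm, thetaTerm_add_one hq, ← zpow_mul, ← zpow_mul]
  have h : (q ^ (k + 1)) ^ 3 * q ^ (((s : ℤ) - 2) * (k + 1)) =
      q ^ (s + 1) * q ^ ((((s + 3 : ℕ) : ℤ) - 2) * k) := by
    rw [← zpow_natCast, ← zpow_mul, ← zpow_natCast, ← zpow_add₀ hq, ← zpow_add₀ hq]
    push_cast
    ring_nf
  linear_combination thetaTerm q k ^ 3 * h

theorem tsum_rankTailTerm {q : ℂ} (hq : q ≠ 0) (hq1 : ‖q‖ < 1) (s : ℕ) :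
    ∑' n : ℕ, rankTailTerm q s (n + 1) =
      q ^ (s + 1) * (1 - ∑' n : ℕ, rankTailTerm q (s + 3) (n + 1)) := by
  rw [(summable_rankTailTerm hq hq1 s).tsum_eq_zero_add, mul_sub, mul_one, ← tsum_mul_left,
    sub_eq_add_neg, ← tsum_neg]
  refine congrArg₂ _ ?_ (tsum_congr fun n => ?_)
  · rw [Nat.cast_zero, zero_add, rankTailTerm_one hq]
  · rw [Nat.cast_succ, rankTailTerm_add_one hq]

theorem norm_tsum_rankTailTerm_le {q : ℂ} (hq : q ≠ 0) (hq1 : ‖q‖ ≤ 1 / 8) (s : ℕ) :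
    ‖∑' n : ℕ, rankTailTerm q s (n + 1)‖ ≤ (1 - 1 / 8)⁻¹ := by
  refine tsum_of_norm_bounded (hasSum_geometric_of_lt_one (by norm_num) (by norm_num)) fun n => ?_
  refine (norm_rankTailTerm_le hq (hq1.trans (by norm_num)) s n).trans ?_
  calc ‖q‖ ^ n * ‖q‖ ^ s ≤ (1 / 8) ^ n * 1 := by
        gcongr
        exact pow_le_one₀ (norm_nonneg q) (hq1.trans (by norm_num))
    _ = (1 / 8) ^ n := mul_one _

theorem rankTailSeries_eq_mul {q : ℂ} (hq : q ≠ 0) (hq1 : ‖q‖ ≤ 1 / 8) (s : ℕ) :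
    rankTailSeries q s = (if s = 0 then 1 else 0) +
      partitionSeries q * ∑' n : ℕ, rankTailTerm q s (n + 1) := by
  set D : ℕ → ℂ := fun s => rankTailSeries q s - (if s = 0 then 1 else 0) -
    partitionSeries q * ∑' n : ℕ, rankTailTerm q s (n + 1) with hD
  have hrec : ∀ s, D s = -(q ^ (s + 1) * D (s + 3)) := fun s => by
    simp only [hD]
    rw [rankTailSeries_eq hq1 s, tsum_rankTailTerm hq (hq1.trans_lt (by norm_num)) s,
      if_neg (Nat.succ_ne_zero (s + 2))]
    ring
  set C : ℝ := (1 - 1 / 4)⁻¹ + 1 + ‖partitionSeries q‖ * (1 - 1 / 8)⁻¹ with hC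
  have hbound : ∀ m s, ‖D s‖ ≤ (1 / 8) ^ m * C := by
    intro m
    induction m with
    | zero =>
      intro s
      rw [pow_zero, one_mul]
      refine (norm_sub_le _ _).trans (add_le_add ((norm_sub_le _ _).trans (add_le_add
        (norm_rankTailSeries_le hq1 s) ?_)) ?_)
      · split_ifs <;> simp
      · rw [norm_mul]
        gcongr
        exact norm_tsum_rankTailTerm_le hq hq1 s
    | succ m ih =>
      intro s
      rw [hrec, norm_neg, norm_mul, norm_pow, pow_succ' (1 / 8 : ℝ), mul_assoc]
      gcongr
      · calc ‖q‖ ^ (s + 1) ≤ ‖q‖ ^ 1 :=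
            pow_le_pow_of_le_one (norm_nonneg q) (hq1.trans (by norm_num)) (Nat.le_add_left 1 s)
          _ ≤ 1 / 8 := by rwa [pow_one]
      · exact ih (s + 3)
  have hlim : Tendsto (fun m : ℕ => (1 / 8 : ℝ) ^ m * C) atTop (𝓝 (0 * C)) :=
    (tendsto_pow_atTop_nhds_zero_of_lt_one (by norm_num) (by norm_num)).mul_const C
  rw [zero_mul] at hlim
  have h0 : D s = 0 := norm_le_zero_iff.1 (ge_of_tendsto' hlim fun m => hbound m s)
  simp only [hD] at h0
  linear_combination h0

theorem tsum_int_eq_zero_add {f : ℤ → ℂ} (hf : Summable f) :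
    ∑' k, f k = f 0 + ∑' n : ℕ, f (n + 1) + ∑' n : ℕ, f (-(n + 1)) := by
  have h1 : Summable fun n : ℕ => f n := hf.comp_injective Nat.cast_injective
  have h2 : Summable fun n : ℕ => f (-(n + 1)) :=
    hf.comp_injective (i := fun n : ℕ => -((n : ℤ) + 1)) fun a b hab => by simpa using hab
  rw [tsum_of_nat_of_neg_add_one h1 h2, h1.tsum_eq_zero_add]
  simp

theorem thetaTerm_cube_neg_mul {q : ℂ} (hq : q ≠ 0) (k : ℤ) (s : ℕ) :
    thetaTerm q (-k) ^ 3 * (q ^ (-1 - (s : ℤ))) ^ (-k) = -rankTailTerm q s k := by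
  have h : (q ^ (-k)) ^ 3 = q ^ (-k * (3 : ℕ)) := by rw [zpow_mul, zpow_natCast]
  rw [thetaTerm_neg hq, rankTailTerm, neg_neg, mul_pow, h, ← zpow_mul, ← zpow_mul, mul_assoc,
    ← zpow_add₀ hq]
  congr 2
  push_cast
  ring

theorem partitionSeries_mul_cubeTheta {q : ℂ} (hq : q ≠ 0) (hq1 : ‖q‖ ≤ 1 / 8) :
    partitionSeries q * cubeTheta q 1 = 1 := by
  have hq1' : ‖q‖ < 1 := hq1.trans_lt (by norm_num)
  have hP : partitionSeries q = rankTailSeries q 0 + rankTailSeries q 1 := by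
    rw [partitionSeries, rankTailSeries, rankTailSeries, ← Summable.tsum_add
      (summable_mul_pow hq1 fun n => norm_rankTail_le n 0)
      (summable_mul_pow hq1 fun n => norm_rankTail_le n 1)]
    exact tsum_congr fun n => by rw [partitionFn_eq_rankTail_add, Nat.cast_add, add_mul]
  have hc : cubeTheta q 1 = ∑' k : ℤ, thetaTerm q k ^ 3 * (q ^ (-1 : ℤ)) ^ k := by
    refine tsum_congr fun k => ?_
    rw [one_zpow, mul_one, ← zpow_mul, neg_one_mul]
  have hs := (summable_thetaTerm_cube_mul_zpow hq hq1' (zpow_ne_zero (-1) hq)).of_norm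
  rw [tsum_int_eq_zero_add hs] at hc
  have h0 : thetaTerm q 0 ^ 3 * (q ^ (-1 : ℤ)) ^ (0 : ℤ) = 1 := by simp [thetaTerm]
  have h1 : ∑' n : ℕ, thetaTerm q (n + 1) ^ 3 * (q ^ (-1 : ℤ)) ^ ((n : ℤ) + 1) =
      -∑' n : ℕ, rankTailTerm q 1 (n + 1) := by
    rw [← tsum_neg]
    exact tsum_congr fun n => by rw [rankTailTerm, neg_neg]; norm_num
  have h2 : ∑' n : ℕ, thetaTerm q (-(n + 1)) ^ 3 * (q ^ (-1 : ℤ)) ^ (-((n : ℤ) + 1)) =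
      -∑' n : ℕ, rankTailTerm q 0 (n + 1) := by
    rw [← tsum_neg]
    exact tsum_congr fun n => thetaTerm_cube_neg_mul hq (n + 1) 0
  rw [h0, h1, h2] at hc
  rw [rankTailSeries_eq_mul hq hq1, rankTailSeries_eq_mul hq hq1, if_pos rfl,
    if_neg one_ne_zero] at hP
  rw [hc]
  linear_combination hP

/-- The quotient by `partitionSeries` of the generating function of `rankTailSum b`. -/
noncomputable def rankTailQuotient (q : ℂ) (b : ℕ) : ℂ :=
  ∑' n : ℕ, rankTailTerm q b (n + 1) * qRecip (q ^ 5) 1 (n + 1)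

theorem tsum_tsum_rankTailTerm {q : ℂ} (hq : q ≠ 0) (hq1 : ‖q‖ ≤ 1 / 8) (b : ℕ) :
    ∑' j : ℕ, ∑' n : ℕ, rankTailTerm q (5 * j + b) (n + 1) = rankTailQuotient q b := by
  have hg : Summable fun n : ℕ => (1 / 8 : ℝ) ^ n :=
    summable_geometric_of_lt_one (by norm_num) (by norm_num)
  have hq1' : ‖q‖ ≤ 1 := hq1.trans (by norm_num)
  have hs : Summable fun p : ℕ × ℕ => rankTailTerm q (5 * p.1 + b) (p.2 + 1) := by
    refine Summable.of_norm_bounded (hg.mul_of_nonneg hg (fun n => by positivity)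
      fun n => by positivity) fun p => (norm_rankTailTerm_le hq hq1' _ _).trans ?_
    rw [mul_comm]
    gcongr
    calc ‖q‖ ^ (5 * p.1 + b) ≤ ‖q‖ ^ p.1 :=
          pow_le_pow_of_le_one (norm_nonneg q) hq1' (by omega)
      _ ≤ (1 / 8) ^ p.1 := by gcongr
  rw [Summable.tsum_comm (f := fun n j : ℕ => rankTailTerm q (5 * j + b) (n + 1)) hs.prod_symm,
    rankTailQuotient]
  refine tsum_congr fun n => ?_
  have hn : ‖q ^ (5 * (n + 1))‖ < 1 := by
    rw [norm_pow]
    exact pow_lt_one₀ (norm_nonneg q) (hq1.trans_lt (by norm_num)) (by omega)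
  rw [qRecip, one_mul, ← zpow_natCast q 5, ← zpow_mul]
  have he : q ^ (((5 : ℕ) : ℤ) * ((n : ℤ) + 1)) = q ^ (5 * (n + 1)) := by
    rw [← zpow_natCast]
    push_cast
    rfl
  rw [he, ← tsum_geometric_of_norm_lt_one hn, ← tsum_mul_left]
  refine tsum_congr fun j => ?_
  rw [rankTailTerm, rankTailTerm, neg_mul, mul_assoc, ← zpow_mul, ← zpow_mul, ← pow_mul,
    ← zpow_natCast q (5 * (n + 1) * j), ← zpow_add₀ hq]
  congr 3
  push_cast
  ring

theorem hasSum_rankTailSum {q : ℂ} (hq : q ≠ 0) (hq1 : ‖q‖ ≤ 1 / 8) {b : ℕ} (hb : b ≠ 0) :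
    HasSum (fun n : ℕ => (rankTailSum b n : ℂ) * q ^ n)
      (partitionSeries q * rankTailQuotient q b) := by
  have hg : Summable fun n : ℕ => (1 / 2 : ℝ) ^ n :=
    summable_geometric_of_lt_one (by norm_num) (by norm_num)
  have hs : Summable fun p : ℕ × ℕ => (rankTail p.1 (5 * p.2 + b) : ℂ) * q ^ p.1 := by
    refine Summable.of_norm_bounded (hg.mul_of_nonneg hg (fun n => by positivity)
      fun n => by positivity) fun p => ?_
    rcases le_or_gt p.1 p.2 with h | h
    · rw [rankTail_eq_zero (by omega) (by omega), Nat.cast_zero, zero_mul, norm_zero]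
      positivity
    · refine (norm_mul_pow_le hq1 (norm_rankTail_le _ _)).trans ?_
      calc (1 / 4 : ℝ) ^ p.1 = (1 / 2) ^ p.1 * (1 / 2) ^ p.1 := by rw [← mul_pow]; norm_num
        _ ≤ (1 / 2) ^ p.1 * (1 / 2) ^ p.2 := by
          gcongr ?_ * ?_
          exact pow_le_pow_of_le_one (by norm_num) (by norm_num) h.le
  have hf : ∀ n : ℕ, HasSum (fun j : ℕ => (rankTail n (5 * j + b) : ℂ) * q ^ n)
      ((rankTailSum b n : ℂ) * q ^ n) := fun n => by
    rw [rankTailSum, Nat.cast_sum, Finset.sum_mul]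
    refine hasSum_sum_of_ne_finset_zero fun j hj => ?_
    rw [Finset.mem_range, not_lt] at hj
    rw [rankTail_eq_zero (by omega) (by omega), Nat.cast_zero, zero_mul]
  have hp := hs.hasSum.prod_fiberwise hf
  have hv : ∑' p : ℕ × ℕ, (rankTail p.1 (5 * p.2 + b) : ℂ) * q ^ p.1 =
      partitionSeries q * rankTailQuotient q b := by
    rw [← tsum_tsum_rankTailTerm hq hq1 b, ← tsum_mul_left, hs.tsum_prod,
      ← Summable.tsum_comm (f := fun n j : ℕ => (rankTail n (5 * j + b) : ℂ) * q ^ n) hs]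
    refine tsum_congr fun j => ?_
    have h := rankTailSeries_eq_mul hq hq1 (5 * j + b)
    rwa [if_neg (by omega), zero_add] at h
  rwa [hv] at hp

theorem rankAppell_eq_sub {q : ℂ} (hq : q ≠ 0) (hq1 : ‖q‖ < 1) {b c s : ℕ} (hbc : s + b = 4)
    (hc : c = b + 2) :
    rankAppell q (q ^ b) = rankTailQuotient q s - rankTailQuotient q c := by
  have hQ : q ^ 5 ≠ 0 := pow_ne_zero 5 hq
  have hQ1 : ‖q ^ 5‖ < 1 := by
    rw [norm_pow]
    exact pow_lt_one₀ (norm_nonneg q) hq1 (by norm_num)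
  have hs := (summable_norm_mul_of_bounded
    (summable_thetaTerm_cube_mul_zpow hq hq1 (pow_ne_zero b hq))
    (exists_norm_qRecip_le hQ hQ1 one_ne_zero)).of_norm
  have h0 : qRecip (q ^ 5) 1 0 = 0 := by simp [qRecip]
  have h1 : ∑' n : ℕ, thetaTerm q (n + 1) ^ 3 * (q ^ b) ^ ((n : ℤ) + 1) *
      qRecip (q ^ 5) 1 (n + 1) = -rankTailQuotient q c := by
    rw [rankTailQuotient, ← tsum_neg]
    refine tsum_congr fun n => ?_
    have e : ((c : ℤ) - 2) = b := by omega
    rw [rankTailTerm, e, zpow_natCast, neg_mul, neg_neg]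
  have h2 : ∑' n : ℕ, thetaTerm q (-(n + 1)) ^ 3 * (q ^ b) ^ (-((n : ℤ) + 1)) *
      qRecip (q ^ 5) 1 (-(n + 1)) = rankTailQuotient q s := by
    refine tsum_congr fun n => ?_
    have e : q ^ b = q ^ (-1 - (s : ℤ)) * q ^ 5 := by
      rw [← zpow_natCast, ← zpow_natCast, ← zpow_add₀ hq]
      congr 1
      push_cast
      omega
    have hr := qRecip_inv_neg hQ one_ne_zero ((n : ℤ) + 1)
    rw [inv_one, one_mul] at hr
    have hz : (q ^ 5) ^ (-((n : ℤ) + 1)) * (q ^ 5) ^ ((n : ℤ) + 1) = 1 := by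
      rw [← zpow_add₀ hQ, neg_add_cancel, zpow_zero]
    rw [e, mul_zpow, ← mul_assoc, thetaTerm_cube_neg_mul hq, hr]
    linear_combination rankTailTerm q s (n + 1) * qRecip (q ^ 5) 1 (n + 1) * hz
  rw [rankAppell, tsum_int_eq_zero_add hs, h0, h1, h2]
  ring

theorem tsum_eq_sum_fin_five {r : ℕ → ℂ} {q : ℂ} (hs : Summable fun n => r n * q ^ n) :
    ∑' n, r n * q ^ n = ∑ i : Fin 5, q ^ (i : ℕ) * ∑' m : ℕ, r (5 * m + i) * (q ^ 5) ^ m := by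
  rw [Nat.sumByResidueClasses hs 5]
  refine Finset.sum_congr rfl fun i _ => ?_
  rw [← tsum_mul_left]
  refine tsum_congr fun m => ?_
  have e : ZMod.val (n := 5) i + 5 * m = 5 * m + @Fin.val 5 i := add_comm _ _
  rw [e, ← pow_mul, pow_add]
  ring

theorem norm_le_of_pow_five {q : ℂ} (h : ‖q ^ 5‖ ≤ (1 / 8) ^ 5) : ‖q‖ ≤ 1 / 8 := by
  rw [norm_pow] at h
  exact le_of_pow_le_pow_left₀ (by norm_num) (by norm_num) h

theorem eq_zero_of_tsum_mul_pow_eq_zero {c : ℕ → ℂ} {ε : ℝ} (hε : 0 < ε)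
    (hc : ∀ y ≠ 0, ‖y‖ ≤ ε → HasSum (fun n => c n * y ^ n) 0) (n : ℕ) : c n = 0 := by
  set d : ℕ → ℂ := fun n => Nat.casesOn n 0 c with hd
  have h : HasFPowerSeriesAt (0 : ℂ → ℂ) (FormalMultilinearSeries.ofScalars ℂ d) 0 := by
    rw [hasFPowerSeriesAt_iff]
    filter_upwards [Metric.closedBall_mem_nhds (0 : ℂ) hε] with y hy
    rw [mem_closedBall_zero_iff] at hy
    simp only [FormalMultilinearSeries.coeff_ofScalars, Pi.zero_apply]
    rcases eq_or_ne y 0 with rfl | hy0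
    · refine hasSum_of_pointwise_eq hasSum_zero fun n => ?_
      cases n with
      | zero => exact smul_zero _
      | succ n => rw [pow_succ, mul_zero, zero_smul]
    · have h := (hasSum_nat_add_iff (f := fun n => y ^ n • d n) 1).1
        (hasSum_of_pointwise_eq ((hc y hy0 hy).mul_left y) fun n => by
          simp only [hd, smul_eq_mul]
          ring)
      simpa [hd] using h
  exact (FormalMultilinearSeries.coeff_ofScalars (𝕜 := ℂ) (p := d) (n := n + 1)).symm.trans
    (congrArg (fun p => FormalMultilinearSeries.coeff p (n + 1)) h.eq_zero)

theorem eq_zero_of_tsum_eq_sum_fin_four {r : ℕ → ℂ}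
    (hs : ∀ q ≠ 0, ‖q‖ ≤ 1 / 8 → Summable fun n => r n * q ^ n)
    (ha : ∀ y ≠ 0, ‖y‖ ≤ (1 / 8) ^ 5 → ∃ a : Fin 4 → ℂ, ∀ q, q ^ 5 = y →
      ∑' n, r n * q ^ n = ∑ i, a i * q ^ (i : ℕ)) (n : ℕ) : r (5 * n + 4) = 0 := by
  refine eq_zero_of_tsum_mul_pow_eq_zero (c := fun n => r (5 * n + 4)) (ε := (1 / 8) ^ 5)
    (by positivity) (fun y hy hy1 => ?_) n
  obtain ⟨a, ha⟩ := ha y hy hy1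
  obtain ⟨q, hq⟩ := IsAlgClosed.exists_pow_nat_eq y (n := 5) (by norm_num)
  have hq0 : q ≠ 0 := by
    rintro rfl
    exact hy (by rw [← hq]; norm_num)
  have hζ := Complex.isPrimitiveRoot_exp 5 (by norm_num)
  set ζ := Complex.exp (2 * Real.pi * Complex.I / (5 : ℕ)) with hζ'
  have hroot : ∀ j : Fin 5, (ζ ^ (j : ℕ) * q) ^ 5 = y := fun j => by
    rw [mul_pow, ← pow_mul, mul_comm (j : ℕ) 5, pow_mul, hζ.pow_eq_one, one_pow, one_mul, hq]
  have hsum : ∀ x, x ^ 5 = y → Summable fun n => r n * x ^ n := fun x hx => by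
    refine hs x ?_ (norm_le_of_pow_five (by rwa [hx]))
    rintro rfl
    exact hy (by rw [← hx]; norm_num)
  have hinj : Function.Injective fun j : Fin 5 => ζ ^ (j : ℕ) * q := fun i j hij =>
    Fin.ext (hζ.pow_inj i.2 j.2 (mul_right_cancel₀ hq0 hij))
  set v : Fin 5 → ℂ := fun i => ∑' m : ℕ, r (5 * m + i) * y ^ m with hv
  have hvan := Matrix.eq_zero_of_forall_index_sum_pow_mul_eq_zero
    (v := fun i => v i - (Fin.snoc a 0 : Fin 5 → ℂ) i) hinj fun j => by
      have h1 := tsum_eq_sum_fin_five (hsum _ (hroot j))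
      rw [ha _ (hroot j), hroot j] at h1
      simp only [mul_sub, Finset.sum_sub_distrib]
      rw [sub_eq_zero, Fin.sum_univ_castSucc (n := 4) fun i =>
        (ζ ^ (j : ℕ) * q) ^ (i : ℕ) * (Fin.snoc a 0 : Fin 5 → ℂ) i, ← h1]
      simp only [Fin.snoc_castSucc, Fin.snoc_last, Fin.val_castSucc, mul_comm, zero_mul, add_zero]
  have h4 := congrFun hvan (Fin.last 4)
  simp only [Fin.snoc_last, sub_zero, Pi.zero_apply] at h4
  have hsm : Summable fun m : ℕ => r (5 * m + 4) * y ^ m := by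
    refine (((hsum q hq).comp_injective (i := fun m : ℕ => 5 * m + 4)
      fun a b hab => by simpa using hab).mul_right (q ^ 4)⁻¹).congr fun m => ?_
    simp only [Function.comp_apply]
    rw [pow_add, pow_mul, hq]
    field_simp
  rw [← h4]
  exact hsm.hasSum

/-- The generating function identities for the differences of rank counts modulo five. -/
theorem hasSum_rankCount_one_two {q : ℂ} (hq : q ≠ 0) (hq1 : ‖q‖ ≤ 1 / 8) :
    HasSum (fun n : ℕ => ((rankCount 1 5 n : ℂ) - rankCount 2 5 n) * q ^ n)
      (partitionSeries q * (2 * rankAppell q 1 + rankAppell q (q ^ 3))) := by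
  have hq1' : ‖q‖ < 1 := hq1.trans_lt (by norm_num)
  have e1 := rankAppell_eq_sub hq hq1' (b := 0) (s := 4) (c := 2) rfl rfl
  have e4 := rankAppell_eq_sub hq hq1' (b := 3) (s := 1) (c := 5) rfl rfl
  rw [pow_zero] at e1
  have h1 := hasSum_rankTailSum hq hq1 (b := 1) (by norm_num)
  have h2 := hasSum_rankTailSum hq hq1 (b := 2) (by norm_num)
  have h4 := hasSum_rankTailSum hq hq1 (b := 4) (by norm_num)
  have h5 := hasSum_rankTailSum hq hq1 (b := 5) (by norm_num)
  have h := ((h1.sub (h2.mul_left 2)).add (h4.mul_left 2)).sub h5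
  have e : partitionSeries q * (2 * rankAppell q 1 + rankAppell q (q ^ 3)) =
      partitionSeries q * rankTailQuotient q 1 - 2 * (partitionSeries q * rankTailQuotient q 2) +
        2 * (partitionSeries q * rankTailQuotient q 4) -
        partitionSeries q * rankTailQuotient q 5 := by
    rw [e1, e4]
    ring
  rw [e]
  refine hasSum_of_pointwise_eq h fun n => ?_
  have r1 := congrArg (Int.cast : ℤ → ℂ) (rankCount_one_five n)
  have r2 := congrArg (Int.cast : ℤ → ℂ) (rankCount_two_five n)
  push_cast at r1 r2
  rw [r1, r2]
  ring

theorem hasSum_rankCount_zero_one {q : ℂ} (hq : q ≠ 0) (hq1 : ‖q‖ ≤ 1 / 8) :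
    HasSum (fun n : ℕ => ((rankCount 0 5 n : ℂ) - rankCount 1 5 n) * q ^ n)
      (partitionSeries q * (1 - 3 * rankAppell q (q ^ 3) - rankAppell q 1)) := by
  have hq1' : ‖q‖ < 1 := hq1.trans_lt (by norm_num)
  have e1 := rankAppell_eq_sub hq hq1' (b := 0) (s := 4) (c := 2) rfl rfl
  have e4 := rankAppell_eq_sub hq hq1' (b := 3) (s := 1) (c := 5) rfl rfl
  rw [pow_zero] at e1
  have h0 : HasSum (fun n : ℕ => (partitionFn n : ℂ) * q ^ n) (partitionSeries q) :=
    (summable_mul_pow hq1 norm_partitionFn_le).hasSum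
  have h1 := hasSum_rankTailSum hq hq1 (b := 1) (by norm_num)
  have h2 := hasSum_rankTailSum hq hq1 (b := 2) (by norm_num)
  have h4 := hasSum_rankTailSum hq hq1 (b := 4) (by norm_num)
  have h5 := hasSum_rankTailSum hq hq1 (b := 5) (by norm_num)
  have h := (((h0.sub (h1.mul_left 3)).add h2).sub h4).add (h5.mul_left 3)
  have e : partitionSeries q * (1 - 3 * rankAppell q (q ^ 3) - rankAppell q 1) =
      partitionSeries q - 3 * (partitionSeries q * rankTailQuotient q 1) +
        partitionSeries q * rankTailQuotient q 2 - partitionSeries q * rankTailQuotient q 4 +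
        3 * (partitionSeries q * rankTailQuotient q 5) := by
    rw [e1, e4]
    ring
  rw [e]
  refine hasSum_of_pointwise_eq h fun n => ?_
  have r0 := congrArg (Int.cast : ℤ → ℂ) (partitionFn_eq_rankCount_add n)
  have r1 := congrArg (Int.cast : ℤ → ℂ) (rankCount_one_five n)
  have r2 := congrArg (Int.cast : ℤ → ℂ) (rankCount_two_five n)
  push_cast at r0 r1 r2
  linear_combination (-r0 - 3 * r1 - 2 * r2) * q ^ n

theorem dyson_5_4 (n : ℕ) :
    rankCount 0 5 (5 * n + 4) = rankCount 1 5 (5 * n + 4) ∧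
    rankCount 1 5 (5 * n + 4) = rankCount 2 5 (5 * n + 4) := by
  have key : ∀ y : ℂ, y ≠ 0 → ‖y‖ ≤ (1 / 8) ^ 5 → ∃ a b : Fin 4 → ℂ, ∀ q, q ^ 5 = y →
      ∑' n, ((rankCount 0 5 n : ℂ) - rankCount 1 5 n) * q ^ n = ∑ i, a i * q ^ (i : ℕ) ∧
      ∑' n, ((rankCount 1 5 n : ℂ) - rankCount 2 5 n) * q ^ n = ∑ i, b i * q ^ (i : ℕ) := by
    intro y hy hy1
    have hy8 : ‖y‖ ≤ 1 / 8 := hy1.trans (by norm_num)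
    have hJ : cubeTheta (y ^ 5) 1 ≠ 0 := by
      refine right_ne_zero_of_mul_eq_one (partitionSeries_mul_cubeTheta (pow_ne_zero 5 hy) ?_)
      rw [norm_pow]
      calc ‖y‖ ^ 5 ≤ (1 / 8) ^ 5 := by gcongr
        _ ≤ 1 / 8 := by norm_num
    obtain ⟨a, b, hab⟩ := exists_rankAppell_eq_cubeTheta_mul hy hy8 hJ
    refine ⟨b, a, fun q hq => ?_⟩
    have hq0 : q ≠ 0 := by
      rintro rfl
      exact hy (by rw [← hq]; norm_num)
    have hq1 : ‖q‖ ≤ 1 / 8 := norm_le_of_pow_five (by rwa [hq])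
    have hP := partitionSeries_mul_cubeTheta hq0 hq1
    rw [(hasSum_rankCount_zero_one hq0 hq1).tsum_eq, (hasSum_rankCount_one_two hq0 hq1).tsum_eq,
      (hab q hq).1, (hab q hq).2, ← mul_assoc, ← mul_assoc, hP, one_mul, one_mul]
    exact ⟨rfl, rfl⟩
  have h01 := eq_zero_of_tsum_eq_sum_fin_four
    (fun q hq hq1 => (hasSum_rankCount_zero_one hq hq1).summable)
    (fun y hy hy1 => (key y hy hy1).imp fun a ⟨_, h⟩ q hq => (h q hq).1) n
  have h12 := eq_zero_of_tsum_eq_sum_fin_four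
    (fun q hq hq1 => (hasSum_rankCount_one_two hq hq1).summable)
    (fun y hy hy1 => (key y hy hy1).elim fun _ ⟨b, h⟩ => ⟨b, fun q hq => (h q hq).2⟩) n
  exact ⟨Nat.cast_injective (sub_eq_zero.1 h01), Nat.cast_injective (sub_eq_zero.1 h12)⟩
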